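/- arXiv:1305.0120 — 2 statements merged into one kernel-verified Lean document; each statement's English description precedes it below -/
import Mathlib

section
/- Let T be a regular interval exchange transformation on [ℓ,r), let J be an admissible semi-interval for T, and let S be the first return map of T on J. A semi-interval I ⊆ J is admissible for T if and only if it is admissible for S; moreover, if I is admissible for T then Div(J,T) ⊆ Div(I,T). -/
open Set

/-- An interval exchange transformation on `[l, r)` exchanging `s` half-open
intervals with boundaries `γ 0 = l < γ 1 < … < γ s = r`, translation values `α`,
and permutation `π` (ordering of the image intervals). -/
structure IET (s : ℕ) where
  l : ℝ
  r : ℝ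
  hlr : l < r
  γ : Fin (s + 1) → ℝ
  γ_mono : StrictMono γ
  γ_first : γ 0 = l
  γ_last : γ (Fin.last s) = r
  α : Fin s → ℝ
  π : Equiv.Perm (Fin s)
  T : ℝ → ℝ
  Tinv : ℝ → ℝ
  hT : ∀ i : Fin s, ∀ x ∈ Ico (γ i.castSucc) (γ i.succ), T x = x + α i
  hmaps : MapsTo T (Ico l r) (Ico l r)
  hinv_left : ∀ x ∈ Ico l r, Tinv (T x) = x
  hinv_right : ∀ x ∈ Ico l r, T (Tinv x) = x
  hinvmaps : MapsTo Tinv (Ico l r) (Ico l r)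
  himg_mono : StrictMono fun k : Fin s => γ (Fin.castSucc (π.symm k)) + α (π.symm k)

namespace IET

variable {s : ℕ} (X : IET s)

/-- The `i`-th exchanged interval `I_i`. -/
def I (i : Fin s) : Set ℝ := Ico (X.γ i.castSucc) (X.γ i.succ)

/-- The separation points `γ_1, …, γ_s` (left boundaries of the `I_i`). -/
def sep (i : Fin s) : ℝ := X.γ i.castSucc

/-- `δ i` : left boundary of the image interval `J_i = T(I_i)`. -/
def δ (i : Fin s) : ℝ := X.γ i.castSucc + X.α i

/-- `ℤ`-iterate of the transformation. -/
def iter (n : ℤ) : ℝ → ℝ := if 0 ≤ n then (X.T)^[n.toNat] else (X.Tinv)^[(-n).toNat]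

/-- The two-sided orbit of a point. -/
def orbit (z : ℝ) : Set ℝ := {y | ∃ n : ℤ, X.iter n z = y}

/-- Minimality: every orbit is dense in `[l, r)`. -/
def Minimal : Prop :=
  ∀ z ∈ Ico X.l X.r, ∀ y ∈ Ico X.l X.r, ∀ ε : ℝ, 0 < ε → ∃ w ∈ X.orbit z, |w - y| < ε

/-- Regularity (Keane's idoc condition): the orbits of the nonzero separation
points are infinite and pairwise disjoint. -/
def Regular : Prop :=
  ∀ i j : Fin s, (i : ℕ) ≠ 0 → (j : ℕ) ≠ 0 → ∀ m n : ℤ,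
    X.iter m (X.sep i) = X.iter n (X.sep j) → i = j ∧ m = n

/-- `I_w` : the set of points whose natural coding begins with the word `w`. -/
def Iw (X : IET s) : List (Fin s) → Set ℝ
  | [] => Ico X.l X.r
  | b :: w => X.I b ∩ X.T ⁻¹' (Iw X w)

/-- `J_w = T^{|w|}(I_w)`. -/
def Jw (w : List (Fin s)) : Set ℝ := (X.T)^[w.length] '' X.Iw w

/-- The factor set `F(T)` of the natural codings of `T`. -/
def Fact : Set (List (Fin s)) := {w | (X.Iw w).Nonempty}

/-- First (positive) return time of `z` to the set `J`. -/
noncomputable def retTime (J : Set ℝ) (z : ℝ) : ℕ := sInf {n : ℕ | 0 < n ∧ (X.T)^[n] z ∈ J}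

/-- First return map of `T` on the set `J`. -/
noncomputable def firstReturn (J : Set ℝ) (z : ℝ) : ℝ := (X.T)^[X.retTime J z] z

/-- `ρ⁺_{[u,v),T}(z) = min {n > 0 | T^n z ∈ (u,v)}`. -/
noncomputable def rhoP (u v z : ℝ) : ℕ := sInf {n : ℕ | 0 < n ∧ X.iter n z ∈ Ioo u v}

/-- `ρ⁻_{[u,v),T}(z) = min {n ≥ 0 | T^{-n} z ∈ (u,v)}`. -/
noncomputable def rhoM (u v z : ℝ) : ℕ := sInf {n : ℕ | X.iter (-(n : ℤ)) z ∈ Ioo u v}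

/-- The set of neighbors of `z` with respect to `[u,v)` and `T`. -/
def nbrs (u v z : ℝ) : Set ℝ :=
  {y | ∃ k : ℤ, -(X.rhoM u v z : ℤ) ≤ k ∧ k < (X.rhoP u v z : ℤ) ∧ X.iter k z = y}

/-- The set of division points of `[u,v)` with respect to `T`. -/
def Div (u v : ℝ) : Set ℝ := ⋃ i : Fin s, X.nbrs u v (X.sep i)

/-- A semi-interval `[u,v) ⊆ [l,r)` is admissible for `T` if both of its
endpoints belong to `Div([u,v),T) ∪ {r}`. -/
def Admissible (u v : ℝ) : Prop :=
  X.l ≤ u ∧ u < v ∧ v ≤ X.r ∧ u ∈ X.Div u v ∧ (v ∈ X.Div u v ∨ v = X.r)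

/-- `Y` is (a presentation of) the transformation induced by `X` on `[u,v)`:
its domain is `[u,v)`, it acts as the first return map of `X`, and its
separation points are the division points of `[u,v)` inside `[u,v)`. -/
def InducedOn (Y : IET s) (u v : ℝ) : Prop :=
  Y.l = u ∧ Y.r = v ∧ (∀ z ∈ Ico u v, Y.T z = X.firstReturn (Ico u v) z) ∧
    {y | ∃ i : Fin s, Y.sep i = y} = X.Div u v ∩ Ico u v

end IET

namespace IET
variable {s : ℕ} (X : IET s)

lemma left_mem : X.l ∈ Ico X.l X.r := ⟨le_refl _, X.hlr⟩

lemma sep_mem (i : Fin s) : X.sep i ∈ Ico X.l X.r := by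
  constructor
  · rw [← X.γ_first]; exact X.γ_mono.monotone (Fin.zero_le _)
  · rw [← X.γ_last]; exact X.γ_mono (Fin.castSucc_lt_last i)

lemma γ_le_r (i : Fin (s+1)) : X.γ i ≤ X.r := by
  rw [← X.γ_last]; exact X.γ_mono.monotone (Fin.le_last i)

lemma l_le_γ (i : Fin (s+1)) : X.l ≤ X.γ i := by
  rw [← X.γ_first]; exact X.γ_mono.monotone (Fin.zero_le _)

lemma exists_idx {x : ℝ} (hx : x ∈ Ico X.l X.r) :
    ∃ i : Fin s, x ∈ Ico (X.γ i.castSucc) (X.γ i.succ) := by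
  by_contra hcon
  push Not at hcon
  have : ∀ i : Fin (s+1), X.γ i ≤ x := by
    intro i
    induction i using Fin.induction with
    | zero => rw [X.γ_first]; exact hx.1
    | succ i ih =>
      by_contra h
      exact hcon i ⟨ih, not_le.mp h⟩
  have h := this (Fin.last s)
  rw [X.γ_last] at h
  exact absurd hx.2 (not_lt.mpr h)

lemma I_mem {i : Fin s} {x : ℝ} (hx : x ∈ Ico (X.γ i.castSucc) (X.γ i.succ)) :
    x ∈ Ico X.l X.r :=
  ⟨(X.l_le_γ _).trans hx.1, hx.2.trans_le (X.γ_le_r _)⟩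

lemma T_inj {x y : ℝ} (hx : x ∈ Ico X.l X.r) (hy : y ∈ Ico X.l X.r) (h : X.T x = X.T y) :
    x = y := by
  rw [← X.hinv_left x hx, ← X.hinv_left y hy, h]

/-- permutation of the domain -/
def perm : Equiv.Perm (Ico X.l X.r) where
  toFun x := ⟨X.T x, X.hmaps x.2⟩
  invFun x := ⟨X.Tinv x, X.hinvmaps x.2⟩
  left_inv x := Subtype.ext (X.hinv_left x x.2)
  right_inv x := Subtype.ext (X.hinv_right x x.2)

lemma perm_pow (n : ℕ) (z : Ico X.l X.r) : ((X.perm ^ n) z : ℝ) = X.T^[n] z := by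
  induction n with
  | zero => rfl
  | succ n ih => rw [pow_succ', Function.iterate_succ_apply', ← ih]; rfl

lemma perm_inv_pow (n : ℕ) (z : Ico X.l X.r) : ((X.perm⁻¹ ^ n) z : ℝ) = X.Tinv^[n] z := by
  induction n with
  | zero => rfl
  | succ n ih => rw [pow_succ', Function.iterate_succ_apply', ← ih]; rfl

lemma iter_nat (n : ℕ) (z : ℝ) : X.iter (n : ℤ) z = X.T^[n] z := by
  simp [iter]

lemma iter_neg_nat (n : ℕ) (z : ℝ) : X.iter (-(n : ℤ)) z = X.Tinv^[n] z := by
  unfold iter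
  rcases Nat.eq_zero_or_pos n with rfl | h
  · simp
  · rw [if_neg (by omega)]; simp

lemma iter_eq (n : ℤ) (z : Ico X.l X.r) : X.iter n z = ((X.perm ^ n) z : ℝ) := by
  obtain ⟨m, rfl | rfl⟩ := n.eq_nat_or_neg
  · rw [iter_nat, zpow_natCast, perm_pow]
  · rw [iter_neg_nat, zpow_neg, zpow_natCast, ← inv_pow, perm_inv_pow]

lemma iter_mem (n : ℤ) {z : ℝ} (hz : z ∈ Ico X.l X.r) : X.iter n z ∈ Ico X.l X.r := by
  rw [X.iter_eq n ⟨z, hz⟩]; exact Subtype.coe_prop _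

lemma iter_add (m n : ℤ) {z : ℝ} (hz : z ∈ Ico X.l X.r) :
    X.iter (m + n) z = X.iter m (X.iter n z) := by
  have h := X.iter_eq n ⟨z, hz⟩
  simp only at h
  rw [h, X.iter_eq m, X.iter_eq (m+n) ⟨z, hz⟩, zpow_add]; rfl

lemma iter_zero (z : ℝ) : X.iter 0 z = z := by simp [iter]
lemma iter_one (z : ℝ) : X.iter 1 z = X.T z := by simp [iter]

lemma Tn_mem (n : ℕ) {z : ℝ} (hz : z ∈ Ico X.l X.r) : X.T^[n] z ∈ Ico X.l X.r := by
  rw [← iter_nat]; exact X.iter_mem _ hz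

lemma Tinvn_mem (n : ℕ) {z : ℝ} (hz : z ∈ Ico X.l X.r) : X.Tinv^[n] z ∈ Ico X.l X.r := by
  rw [← iter_neg_nat]; exact X.iter_mem _ hz

lemma sep_ne_zero_of_gt {i : Fin s} (h : X.l < X.sep i) : (i : ℕ) ≠ 0 := by
  intro h0
  have : X.sep i = X.l := by
    rw [← X.γ_first]; unfold sep; congr 1; ext; simpa using h0
  linarith

lemma sep_zero {i : Fin s} (h : (i : ℕ) = 0) : X.sep i = X.l := by
  rw [← X.γ_first]; unfold sep; congr 1; ext; simpa using h

lemma sep_gt {i : Fin s} (h : (i : ℕ) ≠ 0) : X.l < X.sep i := by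
  rw [← X.γ_first]; unfold sep; apply X.γ_mono
  rw [Fin.lt_def]; simp; omega

lemma sep_T {i : Fin s} : X.T (X.sep i) = X.sep i + X.α i :=
  X.hT i _ ⟨le_refl _, X.γ_mono (Fin.castSucc_lt_succ)⟩

lemma γ_cases (i : Fin (s+1)) : (∃ j : Fin s, X.γ i = X.sep j) ∨ X.γ i = X.r := by
  rcases Fin.eq_castSucc_or_eq_last i with ⟨j, rfl⟩ | rfl
  · exact Or.inl ⟨j, rfl⟩
  · exact Or.inr X.γ_last

/-- the preimage of the left endpoint is a separation point -/
lemma exists_sep_pre_l : ∃ j : Fin s, X.T (X.sep j) = X.l := by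
  have hy := X.hinvmaps X.left_mem
  have hTy := X.hinv_right _ X.left_mem
  obtain ⟨i, hi⟩ := X.exists_idx hy
  refine ⟨i, ?_⟩
  have h1 := X.hT i _ hi
  have h2 := X.sep_T (i := i)
  have h3 := (X.hmaps (X.sep_mem i)).1
  have h4 : X.sep i ≤ X.Tinv X.l := hi.1
  linarith

lemma reg_not_fixed (hreg : X.Regular) {i : Fin s} (hi : (i : ℕ) ≠ 0) {n : ℕ} (hn : 0 < n) :
    X.T^[n] (X.sep i) ≠ X.sep i := by
  intro h
  have := (hreg i i hi hi (n : ℤ) 0 (by rw [iter_nat, iter_zero, h])).2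
  omega

/-- uniqueness through left limits: if `T` maps points just left of `a` to points just left of
`x`, and `x = T y` with `y` not a boundary, then `a = y`. -/
lemma left_limit_inj {a x y e : ℝ} (he : 0 < e) (hy : y ∈ Ico X.l X.r)
    (hyΓ : ∀ j, y ≠ X.sep j) (hTy : X.T y = x)
    (ha : ∀ η, 0 < η → η ≤ e → a - η ∈ Ico X.l X.r ∧ X.T (a - η) = x - η) : a = y := by
  obtain ⟨i, hi⟩ := X.exists_idx hy
  have hlt : X.γ i.castSucc < y := lt_of_le_of_ne hi.1 (fun h => hyΓ i h.symm)
  set η := min e (y - X.γ i.castSucc) with hη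
  have hη0 : 0 < η := lt_min he (by linarith)
  have h1 : η ≤ y - X.γ i.castSucc := min_le_right _ _
  have hm : y - η ∈ Ico (X.γ i.castSucc) (X.γ i.succ) := ⟨by linarith, by linarith [hi.2]⟩
  have h2 := X.hT i _ hm
  have h3 := X.hT i _ hi
  obtain ⟨h4, h5⟩ := ha η hη0 (min_le_left _ _)
  have := X.T_inj h4 (X.I_mem hm) (by rw [h5, h2]; linarith)
  linarith

lemma l_not_fixed (hreg : X.Regular) (hs : 2 ≤ s) : X.T X.l ≠ X.l := by
  intro h
  let i0 : Fin s := ⟨0, by omega⟩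
  let i1 : Fin s := ⟨1, by omega⟩
  have hs0 : X.sep i0 = X.l := X.sep_zero rfl
  have hα : X.α i0 = 0 := by
    have := X.sep_T (i := i0); rw [hs0, h] at this; linarith
  have hsucc : X.γ i0.succ = X.sep i1 := by unfold sep; congr 1
  have h1 : X.l < X.sep i1 := X.sep_gt (by simp [i1])
  have hy := X.hinvmaps (X.sep_mem i1)
  have hTy := X.hinv_right _ (X.sep_mem i1)
  by_cases hc : ∃ j, X.Tinv (X.sep i1) = X.sep j
  · obtain ⟨j, hj⟩ := hc
    rw [hj] at hTy
    by_cases hj0 : (j : ℕ) = 0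
    · rw [X.sep_zero hj0, h] at hTy; linarith
    · have := (hreg j i1 hj0 (by simp [i1]) 1 0 (by rw [iter_one, iter_zero, hTy])).2
      omega
  · push Not at hc
    have := X.left_limit_inj (a := X.sep i1) (e := X.sep i1 - X.l) (by linarith) hy hc hTy (by
      intro η h0 hle
      have hm : X.sep i1 - η ∈ Ico (X.γ i0.castSucc) (X.γ i0.succ) := by
        rw [hsucc]
        refine ⟨?_, by linarith⟩
        change X.sep i0 ≤ _
        rw [hs0]; linarith
      exact ⟨X.I_mem hm, by rw [X.hT _ _ hm, hα]; ring⟩)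
    exact hc i1 this.symm

lemma exists_sep_pre_l' (hreg : X.Regular) (hs : 2 ≤ s) :
    ∃ j : Fin s, (j : ℕ) ≠ 0 ∧ X.T (X.sep j) = X.l := by
  obtain ⟨j, hj⟩ := X.exists_sep_pre_l
  refine ⟨j, fun h0 => ?_, hj⟩
  rw [X.sep_zero h0] at hj
  exact X.l_not_fixed hreg hs hj

/-- no connection: a forward image of a separation point is never a nonzero separation point -/
lemma no_conn (hreg : X.Regular) (hs : 2 ≤ s) {i j : Fin s} (hj : (j : ℕ) ≠ 0) {n : ℕ}
    (hn : 0 < n) : X.T^[n] (X.sep i) ≠ X.sep j := by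
  intro h
  by_cases hi : (i : ℕ) = 0
  · obtain ⟨k, hk, hk'⟩ := X.exists_sep_pre_l' hreg hs
    rw [X.sep_zero hi, ← hk', ← Function.iterate_succ_apply] at h
    have := (hreg k j hk hj ((n+1 : ℕ) : ℤ) 0 (by rw [iter_nat, iter_zero, h])).2
    omega
  · have := (hreg i j hi hj (n : ℤ) 0 (by rw [iter_nat, iter_zero, h])).2
    omega

lemma sep_not_fixed (hreg : X.Regular) (hs : 2 ≤ s) {i : Fin s} {n : ℕ}
    (hn : 0 < n) : X.T^[n] (X.sep i) ≠ X.sep i := by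
  by_cases hi : (i : ℕ) = 0
  · intro h
    obtain ⟨k, hk, hk'⟩ := X.exists_sep_pre_l' hreg hs
    rw [X.sep_zero hi, ← hk', ← Function.iterate_succ_apply, Function.iterate_succ_apply'] at h
    exact X.reg_not_fixed hreg hk hn (X.T_inj (X.Tn_mem _ (X.sep_mem k)) (X.sep_mem k) h)
  · exact X.reg_not_fixed hreg hi hn

/-- no periodic points -/
lemma no_periodic (hreg : X.Regular) (hs : 2 ≤ s) {x : ℝ} (hx : x ∈ Ico X.l X.r) {p : ℕ}
    (hp : 0 < p) : X.T^[p] x ≠ x := by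
  intro hper
  have hex : ∀ k : ℕ, ∃ i : Fin s, X.T^[k] x ∈ Ico (X.γ i.castSucc) (X.γ i.succ) :=
    fun k => X.exists_idx (X.Tn_mem k hx)
  choose i hi using hex
  obtain ⟨k0, -, hk0⟩ := Finset.exists_min_image (Finset.range p)
    (fun k => X.T^[k] x - X.γ (i k).castSucc) ⟨0, by simpa using hp⟩
  set h := X.T^[k0] x - X.γ (i k0).castSucc with hh
  have hpp : Function.IsPeriodicPt X.T p x := hper
  have hh0 : 0 ≤ h := by linarith [(hi k0).1]
  have hmin : ∀ k, h ≤ X.T^[k] x - X.γ (i k).castSucc := by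
    intro k
    have h1 := hk0 (k % p) (by simpa using Nat.mod_lt k hp)
    have h2 : X.T^[k % p] x = X.T^[k] x := hpp.iterate_mod_apply k
    have h3 := hi (k % p)
    rw [h2] at h3 h1
    have h4 := hi k
    have : i (k % p) = i k := by
      rcases lt_trichotomy (i (k % p)) (i k) with hlt | heq | hlt
      · have := X.γ_mono.monotone (show (i (k%p)).succ ≤ (i k).castSucc from by
          rw [Fin.le_def]; simpa using hlt)
        linarith [h3.2, h4.1]
      · exact heq
      · have := X.γ_mono.monotone (show (i k).succ ≤ (i (k%p)).castSucc from by
          rw [Fin.le_def]; simpa using hlt)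
        linarith [h4.2, h3.1]
    rw [this] at h1
    exact h1
  have key : ∀ k, X.T^[k] (x - h) = X.T^[k] x - h := by
    intro k
    induction k with
    | zero => rfl
    | succ k ih =>
      rw [Function.iterate_succ_apply', Function.iterate_succ_apply', ih, X.hT (i k) _ (hi k),
        X.hT (i k) _ ⟨by linarith [hmin k], by linarith [(hi k).2]⟩]
      ring
  have e1 : X.T^[k0] (x - h) = X.sep (i k0) := by rw [key, hh]; unfold sep; ring
  apply X.sep_not_fixed hreg hs (i := i k0) hp
  rw [← e1, ← Function.iterate_add_apply, key, key, Function.iterate_add_apply,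
    (hpp.apply_iterate k0).eq]
end IET

namespace IET

/-- points all of whose neighbourhoods meet `O` in an infinite set -/
def acc (O : Set ℝ) : Set ℝ := {x | ∀ ε > 0, (O ∩ Ioo (x - ε) (x + ε)).Infinite}

lemma acc_isClosed (O : Set ℝ) : IsClosed (acc O) := by
  rw [← isOpen_compl_iff, Metric.isOpen_iff]
  intro x hx
  simp only [acc, mem_compl_iff, mem_ofPred_eq, not_forall, not_infinite] at hx
  obtain ⟨ε, h0, hfin⟩ := hx
  refine ⟨ε / 2, by positivity, fun y hy hyacc => ?_⟩
  rw [Real.ball_eq_Ioo] at hy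
  refine hyacc (ε / 2) (by positivity) (hfin.subset ?_)
  rintro z ⟨hz, hz1, hz2⟩
  exact ⟨hz, by linarith [hy.1], by linarith [hy.2]⟩

lemma exists_acc {O : Set ℝ} {a b : ℝ} (hO : O ⊆ Icc a b) (hinf : O.Infinite) :
    ∃ x ∈ Icc a b, x ∈ acc O := by
  obtain ⟨x, hx, hacc⟩ := hinf.exists_accPt_of_subset_isCompact isCompact_Icc hO
  refine ⟨x, hx, fun ε h0 => ?_⟩
  have := hacc.nhds_inter (Ioo_mem_nhds (show x - ε < x by linarith) (show x < x + ε by linarith))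
  rw [inter_comm] at this
  exact Set.Infinite.of_accPt this

lemma finite_gap {B : Set ℝ} (hB : B.Finite) (c : ℝ) :
    ∃ g > 0, Disjoint (Ioo c (c + g)) B := by
  have hcl : IsClosed (B \ {c}) := (hB.subset sdiff_subset).isClosed
  have : (B \ {c})ᶜ ∈ nhds c := hcl.isOpen_compl.mem_nhds (by simp)
  obtain ⟨g, h0, hg⟩ := Metric.mem_nhds_iff.mp this
  refine ⟨g, h0, Set.disjoint_left.mpr fun x hx hxB => ?_⟩
  refine hg (a := x) ?_ ⟨hxB, ?_⟩
  · rw [Real.ball_eq_Ioo]; exact ⟨by linarith [hx.1], hx.2⟩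
  · intro h; have := hx.1; rw [mem_singleton_iff.mp h] at this; exact lt_irrefl _ this

/-- An injective bounded sequence of points of `W` having right gaps that propagate
outside of a finite set cannot exist. -/
lemma gap_right {W B : Set ℝ} (hB : B.Finite) {c : ℕ → ℝ} (hinj : Function.Injective c)
    (hW : ∀ n, c n ∈ W) {a b : ℝ} (hab : ∀ n, c n ∈ Icc a b)
    (h0 : ∃ g > 0, Disjoint (Ioo (c 0) (c 0 + g)) W)
    (hprop : ∀ n, ∀ g > 0, Disjoint (Ioo (c n) (c n + g)) W → Disjoint (Ioo (c n) (c n + g)) B →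
      Disjoint (Ioo (c (n+1)) (c (n+1) + g)) W) : False := by
  have hex : ∀ n, ∃ g > 0, Disjoint (Ioo (c n) (c n + g)) W := by
    intro n
    induction n with
    | zero => exact h0
    | succ n ih =>
      obtain ⟨g, hg, hd⟩ := ih
      obtain ⟨g', hg', hd'⟩ := finite_gap hB (c n)
      refine ⟨min g g', lt_min hg hg', hprop n _ (lt_min hg hg') (hd.mono_left ?_)
        (hd'.mono_left ?_)⟩
      · exact Ioo_subset_Ioo_right (by linarith [min_le_left g g'])
      · exact Ioo_subset_Ioo_right (by linarith [min_le_right g g'])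
  -- bad indices are finite
  have hbad : ∀ x ∈ B, {n | ∃ g > 0, Disjoint (Ioo (c n) (c n + g)) W ∧
      x ∈ Ioo (c n) (c n + g)}.Finite := by
    intro x _
    apply Set.Subsingleton.finite
    rintro n ⟨g, hg, hd, hx⟩ m ⟨g', hg', hd', hx'⟩
    apply hinj
    rcases lt_trichotomy (c n) (c m) with hlt | heq | hlt
    · exact absurd (hW m) (Set.disjoint_left.mp hd ⟨hlt, hx'.1.trans hx.2⟩)
    · exact heq
    · exact absurd (hW n) (Set.disjoint_left.mp hd' ⟨hlt, hx.1.trans hx'.2⟩)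
  obtain ⟨N, hN⟩ := (hB.biUnion hbad).bddAbove
  have hN' : ∀ n, N < n → ∀ g > 0, Disjoint (Ioo (c n) (c n + g)) W →
      Disjoint (Ioo (c n) (c n + g)) B := by
    intro n hn g hg hd
    refine Set.disjoint_left.mpr fun x hx hxB => ?_
    have : n ≤ N := hN (mem_biUnion hxB ⟨g, hg, hd, hx⟩)
    omega
  obtain ⟨g, hg, hd⟩ := hex (N + 1)
  have hall : ∀ k, Disjoint (Ioo (c (N + 1 + k)) (c (N + 1 + k) + g)) W := by
    intro k
    induction k with
    | zero => exact hd
    | succ k ih => exact hprop (N + 1 + k) g hg ih (hN' (N + 1 + k) (by omega) g hg ih)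
  -- pigeonhole
  let f : ℕ → ℤ := fun k => ⌊(c (N + 1 + k)) / g⌋
  have hf : ∀ k, f k ∈ Set.Icc ⌊a / g⌋ ⌊b / g⌋ := fun k =>
    ⟨Int.floor_le_floor (div_le_div_of_nonneg_right (hab _).1 hg.le),
     Int.floor_le_floor (div_le_div_of_nonneg_right (hab _).2 hg.le)⟩
  have hfi : Function.Injective f := by
    have key : ∀ k m, f k = f m → c (N+1+k) < c (N+1+m) → False := by
      intro k m h hlt
      have h1 : c (N+1+m) < c (N+1+k) + g := by
        have e1 := Int.lt_floor_add_one (c (N+1+m) / g)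
        have e2 := Int.floor_le (c (N+1+k) / g)
        have e3 : (⌊c (N+1+k) / g⌋ : ℝ) = ⌊c (N+1+m) / g⌋ := by exact_mod_cast h
        have e4 : c (N+1+m) / g < c (N+1+k) / g + 1 := by linarith
        have e5 : c (N+1+k) / g + 1 = (c (N+1+k) + g) / g := by field_simp
        rw [e5] at e4
        exact (div_lt_div_iff_of_pos_right hg).mp e4
      exact Set.disjoint_left.mp (hall k) ⟨hlt, h1⟩ (hW _)
    intro k m h
    rcases lt_trichotomy (c (N+1+k)) (c (N+1+m)) with hlt | heq | hlt
    · exact (key k m h hlt).elim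
    · have := hinj heq; omega
    · exact (key m k h.symm hlt).elim
  have : (Set.range f).Finite := (Set.finite_Icc _ _).subset (by rintro _ ⟨k, rfl⟩; exact hf k)
  exact Set.infinite_range_of_injective hfi this

lemma neg_disj {c g : ℝ} {W : Set ℝ} :
    Disjoint (Ioo (-c) (-c + g)) (-W) ↔ Disjoint (Ioo (c - g) c) W := by
  rw [Set.disjoint_left, Set.disjoint_left]
  constructor
  · intro h x hx hxW
    exact h (a := -x) ⟨by linarith [hx.2], by linarith [hx.1]⟩ (by simpa using hxW)
  · intro h x hx hxW
    exact h (a := -x) ⟨by linarith [hx.2], by linarith [hx.1]⟩ (by simpa using hxW)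

lemma gap_left {W B : Set ℝ} (hB : B.Finite) {c : ℕ → ℝ} (hinj : Function.Injective c)
    (hW : ∀ n, c n ∈ W) {a b : ℝ} (hab : ∀ n, c n ∈ Icc a b)
    (h0 : ∃ g > 0, Disjoint (Ioo (c 0 - g) (c 0)) W)
    (hprop : ∀ n, ∀ g > 0, Disjoint (Ioo (c n - g) (c n)) W → Disjoint (Ioo (c n - g) (c n)) B →
      Disjoint (Ioo (c (n+1) - g) (c (n+1))) W) : False := by
  refine gap_right (W := -W) (B := -B) hB.neg (c := fun n => - c n) (a := -b) (b := -a)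
    (fun x y h => hinj (neg_injective h)) (fun n => by simpa using hW n)
    (fun n => ⟨by linarith [(hab n).2], by linarith [(hab n).1]⟩) ?_ ?_
  · obtain ⟨g, hg, h⟩ := h0
    exact ⟨g, hg, neg_disj.mpr h⟩
  · intro n g hg h1 h2
    exact neg_disj.mpr (hprop n g hg (neg_disj.mp h1) (neg_disj.mp h2))

variable {s : ℕ} (X : IET s)

/-- `O` is invariant up to finitely many points -/
structure AI (O : Set ℝ) : Prop where
  sub : O ⊆ Ico X.l X.r
  fwd : {x | x ∈ O ∧ X.T x ∉ O}.Finite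
  bwd : {x | x ∈ Ico X.l X.r ∧ X.T x ∈ O ∧ x ∉ O}.Finite

variable {X}

lemma AI.acc_fwd {O : Set ℝ} (h : X.AI O) {p τ η : ℝ} (hη : 0 < η) (hp : p ∈ acc O)
    (hT : ∀ y ∈ Ico X.l X.r, y ∈ Ioo (p - η) (p + η) → X.T y = y + τ) : p + τ ∈ acc O := by
  intro ε hε
  have h1 := (hp (min ε η) (lt_min hε hη)).sdiff h.fwd
  have h2 := h1.image (f := fun y => y + τ) (fun a _ b _ hab => add_right_cancel hab)
  refine h2.mono ?_
  rintro _ ⟨y, ⟨⟨hyO, hy1, hy2⟩, hy3⟩, rfl⟩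
  have e1 := min_le_left ε η
  have e2 := min_le_right ε η
  refine ⟨?_, by simp only; linarith, by simp only; linarith⟩
  simp only
  rw [← hT y (h.sub hyO) ⟨by linarith, by linarith⟩]
  by_contra hc
  exact hy3 ⟨hyO, hc⟩

lemma AI.acc_bwd {O : Set ℝ} (h : X.AI O) {p τ η : ℝ} (hη : 0 < η) (hp : p + τ ∈ acc O)
    (hT : ∀ y ∈ Ioo (p - η) (p + η), y ∈ Ico X.l X.r ∧ X.T y = y + τ) : p ∈ acc O := by
  intro ε hε
  have h1 := (hp (min ε η) (lt_min hε hη))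
  have h2 := (h1.image (f := fun y => y - τ) (fun a _ b _ hab => by simpa using hab)).sdiff h.bwd
  refine h2.mono ?_
  rintro _ ⟨⟨y, ⟨hyO, hy1, hy2⟩, rfl⟩, hy3⟩
  have e1 := min_le_left ε η
  have e2 := min_le_right ε η
  refine ⟨?_, by simp only; linarith, by simp only; linarith⟩
  simp only at hy3 ⊢
  obtain ⟨hm, hT'⟩ := hT (y - τ) ⟨by linarith, by linarith⟩
  by_contra hc
  exact hy3 ⟨hm, by rw [hT']; simpa using hyO, hc⟩

/-- translation on an open interval transports `acc` -/
lemma AI.acc_iff {O : Set ℝ} (h : X.AI O) {a b x τ : ℝ} (hx : x ∈ Ioo a b)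
    (hT : ∀ y ∈ Ioo a b, y ∈ Ico X.l X.r ∧ X.T y = y + τ) : x + τ ∈ acc O ↔ x ∈ acc O := by
  have h0 : 0 < min (x - a) (b - x) := lt_min (by linarith [hx.1]) (by linarith [hx.2])
  have e1 := min_le_left (x - a) (b - x)
  have e2 := min_le_right (x - a) (b - x)
  have hT' : ∀ y ∈ Ioo (x - min (x - a) (b - x)) (x + min (x - a) (b - x)),
      y ∈ Ico X.l X.r ∧ X.T y = y + τ :=
    fun y hy => hT y ⟨by linarith [hy.1], by linarith [hy.2]⟩
  exact ⟨fun hp => h.acc_bwd h0 hp hT', fun hp => h.acc_fwd h0 hp fun y _ hy => (hT' y hy).2⟩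

variable (X)

lemma TR {y g : ℝ} (hy : y ∈ Ico X.l X.r) (hd : Disjoint (Ioo y (y + g)) (range X.γ)) :
    ∀ x ∈ Ico y (y + g), x ∈ Ico X.l X.r ∧ X.T x = x + (X.T y - y) := by
  obtain ⟨i, hi⟩ := X.exists_idx hy
  have h1 : y + g ≤ X.γ i.succ := by
    by_contra hc
    exact Set.disjoint_left.mp hd ⟨hi.2, not_le.mp hc⟩ ⟨_, rfl⟩
  intro x hx
  have hm : x ∈ Ico (X.γ i.castSucc) (X.γ i.succ) := ⟨hi.1.trans hx.1, hx.2.trans_le h1⟩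
  refine ⟨X.I_mem hm, ?_⟩
  rw [X.hT i x hm, X.hT i y hi]; ring

lemma TL {y g : ℝ} (hy : y ∈ Ico X.l X.r) (hyΓ : ∀ j, y ≠ X.sep j)
    (hd : Disjoint (Ioo (y - g) y) (range X.γ)) :
    ∀ x ∈ Ioc (y - g) y, x ∈ Ico X.l X.r ∧ X.T x = x + (X.T y - y) := by
  obtain ⟨i, hi⟩ := X.exists_idx hy
  have hlt : X.γ i.castSucc < y := lt_of_le_of_ne hi.1 (fun h => hyΓ i h.symm)
  have h1 : X.γ i.castSucc ≤ y - g := by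
    by_contra hc
    exact Set.disjoint_left.mp hd ⟨not_le.mp hc, hlt⟩ ⟨_, rfl⟩
  intro x hx
  have hm : x ∈ Ico (X.γ i.castSucc) (X.γ i.succ) := ⟨h1.trans hx.1.le, hx.2.trans_lt hi.2⟩
  refine ⟨X.I_mem hm, ?_⟩
  rw [X.hT i x hm, X.hT i y hi]; ring

/-- exceptional set for the inverse -/
def exc : Set ℝ := range X.γ ∪ X.T '' range X.γ

lemma exc_finite : X.exc.Finite := (finite_range _).union ((finite_range _).image _)

lemma IR {y g : ℝ} (hy : y ∈ Ico X.l X.r)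
    (hd : Disjoint (Ioo (X.T y) (X.T y + g)) X.exc) :
    ∀ x ∈ Ico y (y + g), x ∈ Ico X.l X.r ∧ X.T x = x + (X.T y - y) := by
  obtain ⟨i, hi⟩ := X.exists_idx hy
  have h1 : y + g ≤ X.γ i.succ := by
    by_contra hc
    push Not at hc
    set e := X.γ i.succ - y with he
    have he0 : 0 < e := by linarith [hi.2]
    have hin : X.T y + e ∈ Ioo (X.T y) (X.T y + g) := ⟨by linarith, by linarith⟩
    have hTy := X.hmaps hy
    have hr : X.T y + g ≤ X.r := by
      by_contra hc
      refine Set.disjoint_left.mp hd ⟨hTy.2, not_le.mp hc⟩ (Or.inl ⟨Fin.last s, X.γ_last⟩)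
    have hm : X.T y + e ∈ Ico X.l X.r := ⟨by linarith [hTy.1], by linarith⟩
    have hy' := X.hinvmaps hm
    have hTy' := X.hinv_right _ hm
    have hns : ∀ j, X.Tinv (X.T y + e) ≠ X.sep j := by
      intro j hj
      refine Set.disjoint_left.mp hd hin (Or.inr ⟨X.sep j, ⟨_, rfl⟩, ?_⟩)
      rw [← hj, hTy']
    have := X.left_limit_inj (a := X.γ i.succ) he0 hy' hns hTy' (by
      intro η h0 hle
      have hmm : X.γ i.succ - η ∈ Ico (X.γ i.castSucc) (X.γ i.succ) :=
        ⟨by linarith [hi.1], by linarith⟩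
      refine ⟨X.I_mem hmm, ?_⟩
      rw [X.hT i _ hmm, X.hT i _ hi]; linarith)
    rcases X.γ_cases i.succ with ⟨j, hj⟩ | hr
    · exact hns j (this.symm.trans hj)
    · linarith [hy'.2]
  intro x hx
  have hm : x ∈ Ico (X.γ i.castSucc) (X.γ i.succ) := ⟨hi.1.trans hx.1, hx.2.trans_le h1⟩
  refine ⟨X.I_mem hm, ?_⟩
  rw [X.hT i x hm, X.hT i y hi]; ring

lemma IL {y g : ℝ} (hy : y ∈ Ico X.l X.r) (hyΓ : ∀ j, y ≠ X.sep j)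
    (hd : Disjoint (Ioo (X.T y - g) (X.T y)) X.exc) :
    ∀ x ∈ Ioc (y - g) y, x ∈ Ico X.l X.r ∧ X.T x = x + (X.T y - y) := by
  obtain ⟨i, hi⟩ := X.exists_idx hy
  have hlt : X.γ i.castSucc < y := lt_of_le_of_ne hi.1 (fun h => hyΓ i h.symm)
  have h1 : X.γ i.castSucc ≤ y - g := by
    by_contra hc
    have e1 := X.sep_T (i := i)
    have e2 := X.hT i y hi
    unfold sep at e1
    refine (Set.disjoint_left.mp hd) (a := X.T (X.γ i.castSucc)) ⟨?_, ?_⟩ (Or.inr ⟨_, ⟨_, rfl⟩, rfl⟩)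
    · linarith
    · linarith
  intro x hx
  have hm : x ∈ Ico (X.γ i.castSucc) (X.γ i.succ) := ⟨h1.trans hx.1.le, hx.2.trans_lt hi.2⟩
  refine ⟨X.I_mem hm, ?_⟩
  rw [X.hT i x hm, X.hT i y hi]; ring

/-- two-sided neighbourhood of translation at a non separation point -/
lemma nbhd {y : ℝ} (hy : y ∈ Ico X.l X.r) (hyΓ : ∀ j, y ≠ X.sep j) :
    ∃ a b, y ∈ Ioo a b ∧ ∀ x ∈ Ioo a b, x ∈ Ico X.l X.r ∧ X.T x = x + (X.T y - y) := by
  obtain ⟨i, hi⟩ := X.exists_idx hy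
  have hlt : X.γ i.castSucc < y := lt_of_le_of_ne hi.1 (fun h => hyΓ i h.symm)
  refine ⟨_, _, ⟨hlt, hi.2⟩, fun x hx => ?_⟩
  have hm := Ioo_subset_Ico_self hx
  refine ⟨X.I_mem hm, ?_⟩
  rw [X.hT i x hm, X.hT i y hi]; ring

variable {X}

lemma AI.acc_T {O : Set ℝ} (h : X.AI O) {y : ℝ} (hy : y ∈ Ico X.l X.r) (hyΓ : ∀ j, y ≠ X.sep j) :
    X.T y ∈ acc O ↔ y ∈ acc O := by
  obtain ⟨a, b, hab, hT⟩ := X.nbhd hy hyΓ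
  have := h.acc_iff hab hT
  rwa [add_sub_cancel] at this

lemma AI.gap_fwd_R {O : Set ℝ} (h : X.AI O) {y g : ℝ}
    (hT : ∀ x ∈ Ico y (y + g), x ∈ Ico X.l X.r ∧ X.T x = x + (X.T y - y)) :
    Disjoint (Ioo y (y + g)) (acc O) ↔ Disjoint (Ioo (X.T y) (X.T y + g)) (acc O) := by
  have key : ∀ x ∈ Ioo y (y+g), x + (X.T y - y) ∈ acc O ↔ x ∈ acc O := fun x hx =>
    h.acc_iff hx fun z hz => hT z (Ioo_subset_Ico_self hz)
  rw [Set.disjoint_left, Set.disjoint_left]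
  constructor
  · intro hd x hx hxa
    have hx' : x - (X.T y - y) ∈ Ioo y (y+g) := ⟨by linarith [hx.1], by linarith [hx.2]⟩
    exact hd hx' ((key _ hx').mp (by rwa [sub_add_cancel]))
  · intro hd x hx hxa
    exact hd (a := x + (X.T y - y)) ⟨by linarith [hx.1], by linarith [hx.2]⟩ ((key _ hx).mpr hxa)

lemma AI.gap_fwd_L {O : Set ℝ} (h : X.AI O) {y g : ℝ}
    (hT : ∀ x ∈ Ioc (y - g) y, x ∈ Ico X.l X.r ∧ X.T x = x + (X.T y - y)) :
    Disjoint (Ioo (y - g) y) (acc O) ↔ Disjoint (Ioo (X.T y - g) (X.T y)) (acc O) := by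
  have key : ∀ x ∈ Ioo (y-g) y, x + (X.T y - y) ∈ acc O ↔ x ∈ acc O := fun x hx =>
    h.acc_iff hx fun z hz => hT z (Ioo_subset_Ioc_self hz)
  rw [Set.disjoint_left, Set.disjoint_left]
  constructor
  · intro hd x hx hxa
    have hx' : x - (X.T y - y) ∈ Ioo (y-g) y := ⟨by linarith [hx.1], by linarith [hx.2]⟩
    exact hd hx' ((key _ hx').mp (by rwa [sub_add_cancel]))
  · intro hd x hx hxa
    exact hd (a := x + (X.T y - y)) ⟨by linarith [hx.1], by linarith [hx.2]⟩ ((key _ hx).mpr hxa)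

end IET

namespace IET
variable {s : ℕ} {X : IET s}

lemma T_gt_l {y : ℝ} (hy : y ∈ Ico X.l X.r) (hyΓ : ∀ j, y ≠ X.sep j) : X.l < X.T y := by
  refine lt_of_le_of_ne (X.hmaps hy).1 fun h => ?_
  obtain ⟨j, hj⟩ := X.exists_sep_pre_l
  exact hyΓ j (X.T_inj hy (X.sep_mem j) (h.symm.trans hj.symm))

lemma T_Tinv_iter (n : ℕ) {d : ℝ} (hd : d ∈ Ico X.l X.r) : X.T^[n] (X.Tinv^[n] d) = d := by
  rw [← iter_nat, ← iter_neg_nat, ← X.iter_add _ _ hd]; simp [iter_zero]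

lemma iter_inj (hreg : X.Regular) (hs : 2 ≤ s) {d : ℝ} (hd : d ∈ Ico X.l X.r) {m n : ℤ}
    (h : X.iter m d = X.iter n d) : m = n := by
  have key : ∀ m n : ℤ, m < n → X.iter m d = X.iter n d → False := by
    intro m n hlt h
    have h1 : X.iter (-m) (X.iter m d) = X.iter (-m) (X.iter n d) := by rw [h]
    rw [← X.iter_add _ _ hd, ← X.iter_add _ _ hd, neg_add_cancel, iter_zero] at h1
    obtain ⟨k, hk⟩ := Int.eq_ofNat_of_zero_le (show 0 ≤ -m + n by omega)
    rw [hk, iter_nat] at h1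
    exact X.no_periodic hreg hs hd (show 0 < k by omega) h1.symm
  rcases lt_trichotomy m n with hlt | heq | hlt
  · exact (key _ _ hlt h).elim
  · exact heq
  · exact (key _ _ hlt h.symm).elim

/-- no boundary points -/
lemma AI.no_boundary (hreg : X.Regular) (hs : 2 ≤ s) {O : Set ℝ} (h : X.AI O) {d : ℝ}
    (hd : d ∈ Ioo X.l X.r) (hda : d ∈ acc O)
    (hgap : (∃ g > 0, Disjoint (Ioo d (d + g)) (acc O)) ∨
      (∃ g > 0, Disjoint (Ioo (d - g) d) (acc O))) : False := by
  have hd' := Ioo_subset_Ico_self hd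
  -- forward orbit hits a separation point
  have hfwd : ∃ n : ℕ, ∃ j : Fin s, (j : ℕ) ≠ 0 ∧ X.T^[n] d = X.sep j := by
    by_contra hcon
    push Not at hcon
    have hall : ∀ n, X.T^[n] d ∈ acc O ∧ X.l < X.T^[n] d ∧ ∀ j, X.T^[n] d ≠ X.sep j := by
      have aux : ∀ n, X.l < X.T^[n] d → ∀ j, X.T^[n] d ≠ X.sep j := by
        intro n hn j hj
        exact hcon n j (X.sep_ne_zero_of_gt (hj ▸ hn)) hj
      intro n
      induction n with
      | zero => exact ⟨hda, hd.1, aux 0 hd.1⟩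
      | succ n ih =>
        obtain ⟨i1, i2, i3⟩ := ih
        have hm := X.Tn_mem n hd'
        have hl : X.l < X.T^[n+1] d := by
          rw [Function.iterate_succ_apply']; exact T_gt_l hm i3
        refine ⟨?_, hl, aux _ hl⟩
        rw [Function.iterate_succ_apply']
        exact (h.acc_T hm i3).mpr i1
    have hinj : Function.Injective fun n : ℕ => X.T^[n] d := by
      intro m n hmn
      simp only [← iter_nat] at hmn
      exact_mod_cast iter_inj hreg hs hd' hmn
    have hIcc : ∀ n, X.T^[n] d ∈ Icc X.l X.r := fun n => Ico_subset_Icc_self (X.Tn_mem n hd')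
    rcases hgap with hg | hg
    · refine gap_right (finite_range X.γ) hinj (fun n => (hall n).1) hIcc hg ?_
      intro n g _ h1 h2
      simp only [Function.iterate_succ_apply']
      exact (h.gap_fwd_R (X.TR (X.Tn_mem n hd') h2)).mp h1
    · refine gap_left (finite_range X.γ) hinj (fun n => (hall n).1) hIcc hg ?_
      intro n g _ h1 h2
      simp only [Function.iterate_succ_apply']
      exact (h.gap_fwd_L (X.TL (X.Tn_mem n hd') (hall n).2.2 h2)).mp h1
  have hbwd : ∃ m : ℕ, 0 < m ∧ ∃ i : Fin s, X.Tinv^[m] d = X.sep i := by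
    by_contra hcon
    push Not at hcon
    have hTs : ∀ n, X.T (X.Tinv^[n+1] d) = X.Tinv^[n] d := by
      intro n
      rw [Function.iterate_succ_apply', X.hinv_right _ (X.Tinvn_mem n hd')]
    have hall : ∀ n, X.Tinv^[n] d ∈ acc O := by
      intro n
      induction n with
      | zero => exact hda
      | succ n ih =>
        have hm := X.Tinvn_mem (n+1) hd'
        exact (h.acc_T hm (hcon (n+1) (by omega))).mp (by rw [hTs]; exact ih)
    have hinj : Function.Injective fun n : ℕ => X.Tinv^[n] d := by
      intro m n hmn
      simp only [← iter_neg_nat] at hmn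
      have := iter_inj hreg hs hd' hmn
      omega
    have hIcc : ∀ n, X.Tinv^[n] d ∈ Icc X.l X.r := fun n =>
      Ico_subset_Icc_self (X.Tinvn_mem n hd')
    rcases hgap with hg | hg
    · refine gap_right X.exc_finite hinj hall hIcc hg ?_
      intro n g _ h1 h2
      have hm := X.Tinvn_mem (n+1) hd'
      rw [← hTs n] at h1 h2
      exact (h.gap_fwd_R (X.IR hm h2)).mpr h1
    · refine gap_left X.exc_finite hinj hall hIcc hg ?_
      intro n g _ h1 h2
      have hm := X.Tinvn_mem (n+1) hd'
      rw [← hTs n] at h1 h2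
      exact (h.gap_fwd_L (X.IL hm (hcon (n+1) (by omega)) h2)).mpr h1
  obtain ⟨n, j, hj0, hj⟩ := hfwd
  obtain ⟨m, hm0, i, hi⟩ := hbwd
  apply X.no_conn hreg hs hj0 (i := i) (n := n + m) (by omega)
  rw [← hi, Function.iterate_add_apply, T_Tinv_iter m hd', hj]

lemma AI.acc_interior (hreg : X.Regular) (hs : 2 ≤ s) {O : Set ℝ} (h : X.AI O)
    (hinf : O.Infinite) : ∃ p ∈ Ioo X.l X.r, p ∈ acc O := by
  obtain ⟨p, hp, hpa⟩ := exists_acc (h.sub.trans Ico_subset_Icc_self) hinf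
  rcases eq_or_lt_of_le hp.1 with hl | hl
  · -- p = l
    have hTl : X.l < X.T X.l :=
      lt_of_le_of_ne (X.hmaps X.left_mem).1 (X.l_not_fixed hreg hs).symm
    refine ⟨X.T X.l, ⟨hTl, (X.hmaps X.left_mem).2⟩, ?_⟩
    obtain ⟨g, hg, hd⟩ := finite_gap (finite_range X.γ) X.l
    have hT := X.TR X.left_mem hd
    have := h.acc_fwd (τ := X.T X.l - X.l) hg hpa (by
      intro y hy hy2
      exact (hT y ⟨hy.1, by rw [hl]; exact hy2.2⟩).2)
    rw [← hl] at this
    rwa [add_sub_cancel] at this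
  rcases eq_or_lt_of_le hp.2 with hr | hr
  · -- p = r
    let i1 : Fin s := ⟨s - 1, by omega⟩
    have hi1 : X.γ i1.succ = X.r := by
      rw [← X.γ_last]; congr 1; ext; simp [i1]; omega
    have hi10 : (i1 : ℕ) ≠ 0 := by simp [i1]; omega
    have hlt : X.sep i1 < X.r := (X.sep_mem i1).2
    have hT : ∀ y, X.sep i1 ≤ y → y < X.r → X.T y = y + X.α i1 := fun y h1 h2 =>
      X.hT i1 y ⟨h1, by rw [hi1]; exact h2⟩
    have h1 : X.α i1 ≤ 0 := by
      by_contra hc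
      push Not at hc
      set y := max (X.sep i1) (X.r - X.α i1) with hy
      have e1 : X.sep i1 ≤ y := le_max_left _ _
      have e2 : X.r - X.α i1 ≤ y := le_max_right _ _
      have e3 : y < X.r := max_lt hlt (by linarith)
      have := (X.hmaps (x := y) ⟨(X.sep_mem i1).1.trans e1, e3⟩).2
      rw [hT y e1 e3] at this
      linarith
    have h2 : X.α i1 ≠ 0 := by
      intro h0
      apply X.reg_not_fixed hreg hi10 (n := 1) one_pos
      simp [hT _ le_rfl hlt, h0]
    have h3 : X.α i1 < 0 := lt_of_le_of_ne h1 h2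
    have h4 := (X.hmaps (X.sep_mem i1)).1
    rw [hT _ le_rfl hlt] at h4
    refine ⟨X.r + X.α i1, ⟨by linarith, by linarith⟩, ?_⟩
    rw [hr] at hpa
    refine h.acc_fwd (η := X.r - X.sep i1) (by linarith) hpa ?_
    intro y hy hy2
    exact hT y (by linarith [hy2.1]) hy.2
  · exact ⟨p, ⟨hl, hr⟩, hpa⟩

lemma AI.dense (hreg : X.Regular) (hs : 2 ≤ s) {O : Set ℝ} (h : X.AI O)
    (hinf : O.Infinite) {u v : ℝ} (hu : X.l ≤ u) (huv : u < v) (hv : v ≤ X.r) :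
    ∃ y ∈ O, y ∈ Ioo u v := by
  by_contra hcon
  push Not at hcon
  obtain ⟨p, hp, hpa⟩ := h.acc_interior hreg hs hinf
  set x0 := (u + v) / 2 with hx0
  have hx0a : x0 ∉ acc O := by
    intro hx
    refine hx ((v - u) / 2) (by linarith) ?_
    convert Set.finite_empty
    rw [Set.eq_empty_iff_forall_notMem]
    rintro y ⟨hyO, hy1, hy2⟩
    exact hcon y hyO ⟨by linarith, by linarith⟩
  have hne : p ≠ x0 := fun e => hx0a (e ▸ hpa)
  rcases lt_or_gt_of_ne hne with hlt | hlt
  · have hc : IsCompact (acc O ∩ Icc p x0) := isCompact_Icc.inter_left (acc_isClosed O)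
    obtain ⟨d, ⟨hda, hd1, hd2⟩, hmax⟩ := hc.exists_isGreatest ⟨p, hpa, le_rfl, hlt.le⟩
    have hd3 : d < x0 := lt_of_le_of_ne hd2 (fun e => hx0a (e ▸ hda))
    refine h.no_boundary hreg hs (d := d) ⟨hp.1.trans_le hd1, by linarith⟩ hda
      (Or.inl ⟨x0 - d, by linarith, Set.disjoint_left.mpr fun x hx hxa => ?_⟩)
    have := hmax (a := x) ⟨hxa, by linarith [hx.1], by linarith [hx.2]⟩
    linarith [hx.1]
  · have hc : IsCompact (acc O ∩ Icc x0 p) := isCompact_Icc.inter_left (acc_isClosed O)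
    obtain ⟨d, ⟨hda, hd1, hd2⟩, hmin⟩ := hc.exists_isLeast ⟨p, hpa, hlt.le, le_rfl⟩
    have hd3 : x0 < d := lt_of_le_of_ne hd1 (fun e => hx0a (e ▸ hda))
    refine h.no_boundary hreg hs (d := d) ⟨by linarith, hd2.trans_lt hp.2⟩ hda
      (Or.inr ⟨d - x0, by linarith, Set.disjoint_left.mpr fun x hx hxa => ?_⟩)
    have := hmin (a := x) ⟨hxa, by linarith [hx.1], by linarith [hx.2]⟩
    linarith [hx.2]

lemma hit_fwd (hreg : X.Regular) (hs : 2 ≤ s) {z : ℝ} (hz : z ∈ Ico X.l X.r)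
    {u v : ℝ} (hu : X.l ≤ u) (huv : u < v) (hv : v ≤ X.r) :
    ∃ n : ℕ, 0 < n ∧ X.iter n z ∈ Ioo u v := by
  have hz' := X.hmaps hz
  have hAI : X.AI (range fun n : ℕ => X.T^[n] (X.T z)) := by
    refine ⟨?_, ?_, ?_⟩
    · rintro _ ⟨n, rfl⟩; exact X.Tn_mem n hz'
    · convert Set.finite_empty
      rw [Set.eq_empty_iff_forall_notMem]
      rintro _ ⟨⟨n, rfl⟩, h⟩
      exact h ⟨n + 1, Function.iterate_succ_apply' _ _ _⟩
    · refine (Set.finite_singleton z).subset ?_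
      rintro x ⟨hx, ⟨n, hn⟩, h⟩
      cases n with
      | zero => exact (X.T_inj hz hx hn).symm
      | succ n =>
        simp only [Function.iterate_succ_apply' _ n] at hn
        exact (h ⟨n, X.T_inj (X.Tn_mem n hz') hx hn⟩).elim
  have hinf : (range fun n : ℕ => X.T^[n] (X.T z)).Infinite := by
    apply Set.infinite_range_of_injective
    intro m n hmn
    simp only [← iter_nat] at hmn
    exact_mod_cast iter_inj hreg hs hz' hmn
  obtain ⟨_, ⟨n, rfl⟩, hy⟩ := hAI.dense hreg hs hinf hu huv hv
  refine ⟨n + 1, by omega, ?_⟩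
  rw [iter_nat]; exact hy

lemma hit_bwd (hreg : X.Regular) (hs : 2 ≤ s) {z : ℝ} (hz : z ∈ Ico X.l X.r)
    {u v : ℝ} (hu : X.l ≤ u) (huv : u < v) (hv : v ≤ X.r) :
    ∃ n : ℕ, X.iter (-(n : ℤ)) z ∈ Ioo u v := by
  have hTs : ∀ n, X.T (X.Tinv^[n+1] z) = X.Tinv^[n] z := by
    intro n
    rw [Function.iterate_succ_apply', X.hinv_right _ (X.Tinvn_mem n hz)]
  have hAI : X.AI (range fun n : ℕ => X.Tinv^[n] z) := by
    refine ⟨?_, ?_, ?_⟩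
    · rintro _ ⟨n, rfl⟩; exact X.Tinvn_mem n hz
    · refine (Set.finite_singleton z).subset ?_
      rintro _ ⟨⟨n, rfl⟩, h⟩
      cases n with
      | zero => rfl
      | succ n => exact (h ⟨n, (hTs n).symm⟩).elim
    · convert Set.finite_empty
      rw [Set.eq_empty_iff_forall_notMem]
      rintro x ⟨hx, ⟨n, hn⟩, h⟩
      refine h ⟨n + 1, X.T_inj (X.Tinvn_mem _ hz) hx ?_⟩
      rw [hTs]; exact hn
  have hinf : (range fun n : ℕ => X.Tinv^[n] z).Infinite := by
    apply Set.infinite_range_of_injective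
    intro m n hmn
    simp only [← iter_neg_nat] at hmn
    have := iter_inj hreg hs hz hmn
    omega
  obtain ⟨_, ⟨n, rfl⟩, hy⟩ := hAI.dense hreg hs hinf hu huv hv
  refine ⟨n, ?_⟩
  rw [iter_neg_nat]; exact hy

end IET

namespace IET
variable {s : ℕ} {X : IET s}

lemma mem_nbrs_iff {u v z : ℝ} (hP : ∃ n : ℕ, 0 < n ∧ X.iter n z ∈ Ioo u v)
    (hM : ∃ n : ℕ, X.iter (-(n : ℤ)) z ∈ Ioo u v) {y : ℝ} :
    y ∈ X.nbrs u v z ↔ ∃ k : ℤ, X.iter k z = y ∧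
      ∀ m : ℤ, (k < m ∧ m ≤ 0 ∨ 0 < m ∧ m ≤ k) → X.iter m z ∉ Ioo u v := by
  have hP' : 0 < X.rhoP u v z ∧ X.iter (X.rhoP u v z) z ∈ Ioo u v := Nat.sInf_mem hP
  have hM' : X.iter (-(X.rhoM u v z : ℤ)) z ∈ Ioo u v := Nat.sInf_mem hM
  constructor
  · rintro ⟨k, h1, h2, rfl⟩
    refine ⟨k, rfl, ?_⟩
    rintro m (⟨h3, h4⟩ | ⟨h3, h4⟩) hm
    · obtain ⟨n, hn⟩ := Int.eq_ofNat_of_zero_le (show 0 ≤ -m by omega)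
      have : X.rhoM u v z ≤ n := Nat.sInf_le (show X.iter (-(n : ℤ)) z ∈ Ioo u v by
        rw [← hn, neg_neg]; exact hm)
      omega
    · obtain ⟨n, rfl⟩ := Int.eq_ofNat_of_zero_le h3.le
      have : X.rhoP u v z ≤ n := Nat.sInf_le ⟨by omega, hm⟩
      omega
  · rintro ⟨k, rfl, h⟩
    refine ⟨k, ?_, ?_, rfl⟩
    · by_contra hc
      exact h (-(X.rhoM u v z : ℤ)) (Or.inl ⟨by omega, by omega⟩) hM'
    · by_contra hc
      exact h (X.rhoP u v z : ℤ) (Or.inr ⟨by omega, by omega⟩) hP'.2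

/-- cumulative return time -/
noncomputable def cum (r : ℤ → ℤ) (m : ℤ) : ℤ :=
  if 0 ≤ m then ∑ i ∈ Finset.range m.toNat, r i
  else - ∑ i ∈ Finset.range (-m).toNat, r (-(i : ℤ) - 1)

lemma cum_zero (r : ℤ → ℤ) : cum r 0 = 0 := by simp [cum]

lemma cum_succ (r : ℤ → ℤ) (m : ℤ) : cum r (m + 1) = cum r m + r m := by
  rcases le_or_gt 0 m with h | h
  · obtain ⟨n, rfl⟩ := Int.eq_ofNat_of_zero_le h
    unfold cum
    rw [if_pos (by omega), if_pos h]
    have : ((n : ℤ) + 1).toNat = n + 1 := by omega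
    rw [this, Finset.sum_range_succ]; simp
  · obtain ⟨n, hn⟩ := Int.eq_ofNat_of_zero_le (show 0 ≤ -m - 1 by omega)
    obtain rfl : m = -(n : ℤ) - 1 := by omega
    rcases Nat.eq_zero_or_pos n with rfl | hn0
    · simp [cum]
    · unfold cum
      rw [if_neg (by omega), if_neg (by omega)]
      have e1 : (-(-(n : ℤ) - 1 + 1)).toNat = n := by omega
      have e2 : (-(-(n : ℤ) - 1)).toNat = n + 1 := by omega
      rw [e1, e2, Finset.sum_range_succ]; ring

lemma exists_phi {S : IET s} {t w : ℝ} (hS : X.InducedOn S t w) (hlt : X.l ≤ t) (hwr : w ≤ X.r)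
    (hits : ∀ z ∈ Ico X.l X.r, ∃ n : ℕ, 0 < n ∧ X.iter n z ∈ Ioo t w)
    {x : ℝ} (hx : x ∈ Ico t w) :
    ∃ φ : ℤ → ℤ, StrictMono φ ∧ φ 0 = 0 ∧ (∀ m, S.iter m x = X.iter (φ m) x) ∧
      ∀ k, X.iter k x ∈ Ico t w → ∃ m, φ m = k := by
  obtain ⟨hl, hr, hT, -⟩ := hS
  have hsub : Ico t w ⊆ Ico X.l X.r := Ico_subset_Ico hlt hwr
  have hret : ∀ z ∈ Ico t w, 0 < X.retTime (Ico t w) z := by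
    intro z hz
    obtain ⟨n, hn, hn'⟩ := hits z (hsub hz)
    have : X.retTime (Ico t w) z ∈ {n : ℕ | 0 < n ∧ (X.T)^[n] z ∈ Ico t w} :=
      Nat.sInf_mem ⟨n, hn, by rw [← iter_nat]; exact Ioo_subset_Ico_self hn'⟩
    exact this.1
  have hxS : x ∈ Ico S.l S.r := by rw [hl, hr]; exact hx
  have hSm : ∀ m, S.iter m x ∈ Ico t w := by
    intro m; have := S.iter_mem m hxS; rwa [hl, hr] at this
  let r : ℤ → ℤ := fun m => (X.retTime (Ico t w) (S.iter m x) : ℤ)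
  have hstep : ∀ m, S.iter (m + 1) x = X.iter (r m) (S.iter m x) := by
    intro m
    rw [add_comm, S.iter_add _ _ hxS, iter_one, hT _ (hSm m), iter_nat]; rfl
  have hmono : StrictMono (cum r) := by
    apply strictMono_int_of_lt_succ
    intro m
    rw [cum_succ]
    have := hret _ (hSm m)
    simp only [r]; omega
  have heq : ∀ m, S.iter m x = X.iter (cum r m) x := by
    intro m
    induction m using Int.induction_on with
    | zero => rw [cum_zero, iter_zero, iter_zero]
    | succ n ih => rw [hstep, cum_succ, ih, add_comm (cum r n), X.iter_add _ _ (hsub hx)]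
    | pred n ih =>
      have h1 := hstep (-(n : ℤ) - 1)
      have h2 := cum_succ r (-(n : ℤ) - 1)
      rw [sub_add_cancel] at h1 h2
      rw [ih, h2, add_comm, X.iter_add _ _ (hsub hx)] at h1
      have h3 := congrArg (X.iter (-(r (-(n:ℤ) - 1)))) h1
      rw [← X.iter_add _ _ (X.iter_mem _ (hsub hx)), ← X.iter_add _ _ (hsub (hSm _)),
        neg_add_cancel, iter_zero, iter_zero] at h3
      exact h3.symm
  refine ⟨cum r, hmono, cum_zero r, heq, ?_⟩
  intro k hk
  have hge : ∀ n : ℕ, (n : ℤ) ≤ cum r n := by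
    intro n
    induction n with
    | zero => simp [cum_zero]
    | succ n ih =>
      have := hmono (show (n : ℤ) < ((n + 1 : ℕ) : ℤ) by push_cast; omega)
      push_cast at this ⊢; omega
  have hle : ∀ n : ℕ, cum r (-(n : ℤ)) ≤ -(n : ℤ) := by
    intro n
    induction n with
    | zero => simp [cum_zero]
    | succ n ih =>
      have := hmono (show -((n + 1 : ℕ) : ℤ) < -(n : ℤ) by push_cast; omega)
      push_cast at this ⊢; omega
  obtain ⟨m, hm, hmax⟩ := Int.exists_greatest_of_bdd (P := fun m => cum r m ≤ k)
    ⟨k.natAbs, fun z hz => by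
      by_contra hc
      push Not at hc
      have h1 := hmono hc
      have h2 := hge k.natAbs
      omega⟩ ⟨-(k.natAbs : ℤ), by have := hle k.natAbs; omega⟩
  refine ⟨m, ?_⟩
  by_contra hne
  have hlt' : cum r m < k := lt_of_le_of_ne hm hne
  have hk2 : k < cum r (m + 1) := by
    by_contra hc
    have := hmax (m + 1) (not_lt.mp hc)
    omega
  rw [cum_succ] at hk2
  obtain ⟨n, hn⟩ := Int.eq_ofNat_of_zero_le (show 0 ≤ k - cum r m by omega)
  have hmem : X.retTime (Ico t w) (S.iter m x) ≤ n := by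
    apply Nat.sInf_le
    refine ⟨by omega, ?_⟩
    rw [← iter_nat, heq m, ← X.iter_add _ _ (hsub hx), ← hn, sub_add_cancel]
    exact hk
  have hr' : r m = (X.retTime (Ico t w) (S.iter m x) : ℤ) := rfl
  rw [hr'] at hk2
  omega

lemma two_le (hJ : ∃ t w, X.Admissible t w) : 2 ≤ s := by
  obtain ⟨t, w, hlt, htw, hwr, hD, -⟩ := hJ
  by_contra hs
  obtain ⟨i, hi⟩ := mem_iUnion.mp hD
  have hs1 : s = 1 := by have := i.2; omega
  subst hs1
  have hall : ∀ j : Fin 1, X.sep j = X.l := fun j => X.sep_zero (by omega)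
  have hTl : X.T X.l = X.l := by
    obtain ⟨j, hj⟩ := X.exists_sep_pre_l
    rwa [hall j] at hj
  have hTi : X.Tinv X.l = X.l := by
    have := X.hinv_left _ X.left_mem
    rwa [hTl] at this
  have h1 : ∀ n : ℕ, X.iter n X.l = X.l := by
    intro n; rw [iter_nat]; exact Function.iterate_fixed hTl n
  have h2 : ∀ n : ℕ, X.iter (-(n : ℤ)) X.l = X.l := by
    intro n; rw [iter_neg_nat]; exact Function.iterate_fixed hTi n
  obtain ⟨k, hk1, hk2, -⟩ := hi
  rw [hall i] at hk1 hk2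
  have e1 : X.rhoP t w X.l = 0 := by
    unfold rhoP
    simp only [h1]
    convert Nat.sInf_empty
    ext n; simp; intro _ h; linarith
  have e2 : X.rhoM t w X.l = 0 := by
    unfold rhoM
    simp only [h2]
    convert Nat.sInf_empty
    ext n; simp; intro h; linarith
  rw [e1] at hk2; rw [e2] at hk1
  simp at hk1 hk2
  omega

end IET

/-- for `J = [t,w)` admissible for `T` and `S` the transformation
induced by `T` on `J`, a semi-interval `I = [u,v) ⊆ J` is admissible for `T`
iff it is admissible for `S`; moreover in this case `Div(J,T) ⊆ Div(I,T)`. -/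
theorem iet_admissible_transfer {s : ℕ} (X : IET s) (hreg : X.Regular)
    (t w : ℝ) (hJ : X.Admissible t w) (S : IET s) (hS : X.InducedOn S t w)
    (u v : ℝ) (hu : t ≤ u) (huv : u < v) (hv : v ≤ w) :
    (X.Admissible u v ↔ S.Admissible u v) ∧
    (X.Admissible u v → X.Div t w ⊆ X.Div u v) := by
  have hs : 2 ≤ s := IET.two_le ⟨t, w, hJ⟩
  obtain ⟨hlt, htw, hwr, htD, hwD⟩ := hJ
  have hlu := hlt.trans hu
  have hvr := hv.trans hwr
  have hIJ : Ioo u v ⊆ Ioo t w := Ioo_subset_Ioo hu hv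
  have hsub : Ico t w ⊆ Ico X.l X.r := Ico_subset_Ico hlt hwr
  have Pu := fun z (hz : z ∈ Ico X.l X.r) => IET.hit_fwd hreg hs hz hlu huv hvr
  have Mu := fun z (hz : z ∈ Ico X.l X.r) => IET.hit_bwd hreg hs hz hlu huv hvr
  have Pt := fun z (hz : z ∈ Ico X.l X.r) => IET.hit_fwd hreg hs hz hlt htw hwr
  have Mt := fun z (hz : z ∈ Ico X.l X.r) => IET.hit_bwd hreg hs hz hlt htw hwr
  have Nu := fun (i : Fin s) (y : ℝ) =>
    IET.mem_nbrs_iff (Pu _ (X.sep_mem i)) (Mu _ (X.sep_mem i)) (y := y)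
  have Nt := fun (i : Fin s) (y : ℝ) =>
    IET.mem_nbrs_iff (Pt _ (X.sep_mem i)) (Mt _ (X.sep_mem i)) (y := y)
  have hDiv : X.Div t w ⊆ X.Div u v := by
    intro y hy
    obtain ⟨i, hi⟩ := mem_iUnion.mp hy
    obtain ⟨k, hk, h⟩ := (Nt i y).mp hi
    exact mem_iUnion.mpr ⟨i, (Nu i y).mpr ⟨k, hk, fun m hm hmm => h m hm (hIJ hmm)⟩⟩
  have hφ := fun x (hx : x ∈ Ico t w) => IET.exists_phi hS hlt hwr Pt hx
  obtain ⟨hSl, hSr, -, hsep⟩ := hS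
  have hSsep : ∀ i, S.sep i ∈ X.Div t w ∩ Ico t w := by
    intro i; rw [← hsep]; exact ⟨i, rfl⟩
  -- neighbours for S
  have NS : ∀ (i : Fin s) (y : ℝ), y ∈ S.nbrs u v (S.sep i) ↔ ∃ k : ℤ, S.iter k (S.sep i) = y ∧
      ∀ m : ℤ, (k < m ∧ m ≤ 0 ∨ 0 < m ∧ m ≤ k) → S.iter m (S.sep i) ∉ Ioo u v := by
    intro i y
    have hσ := (hSsep i).2
    obtain ⟨φ, hmono, h0, heq, hsurj⟩ := hφ _ hσ
    apply IET.mem_nbrs_iff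
    · obtain ⟨n, hn, hn'⟩ := Pu _ (hsub hσ)
      obtain ⟨m, hm⟩ := hsurj n (Ioo_subset_Ico_self (hIJ hn'))
      have hm0 : 0 < m := by rw [← hmono.lt_iff_lt, h0, hm]; omega
      obtain ⟨m', rfl⟩ := Int.eq_ofNat_of_zero_le hm0.le
      exact ⟨m', by omega, by rw [heq, hm]; exact hn'⟩
    · obtain ⟨n, hn'⟩ := Mu _ (hsub hσ)
      obtain ⟨m, hm⟩ := hsurj (-(n : ℤ)) (Ioo_subset_Ico_self (hIJ hn'))
      have hm0 : m ≤ 0 := by rw [← hmono.le_iff_le, h0, hm]; omega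
      obtain ⟨m', hm'⟩ := Int.eq_ofNat_of_zero_le (show 0 ≤ -m by omega)
      exact ⟨m', by rw [← hm', neg_neg, heq, hm]; exact hn'⟩
  have hmain : S.Div u v = X.Div u v ∩ Ico t w := by
    ext y
    constructor
    · intro hy
      obtain ⟨i, hi⟩ := mem_iUnion.mp hy
      obtain ⟨m, rfl, hSm⟩ := (NS i y).mp hi
      obtain ⟨hσD, hσ⟩ := hSsep i
      obtain ⟨φ, hmono, h0, heq, hsurj⟩ := hφ _ hσ
      refine ⟨?_, ?_⟩
      · obtain ⟨j, hj⟩ := mem_iUnion.mp hσD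
        obtain ⟨k, hk, hav⟩ := (Nt j _).mp hj
        have hz := X.sep_mem j
        refine mem_iUnion.mpr ⟨j, (Nu j _).mpr ⟨φ m + k, ?_, ?_⟩⟩
        · rw [heq, X.iter_add _ _ hz, hk]
        · intro q hq hqI
          have e : X.iter (q - k) (S.sep i) = X.iter q (X.sep j) := by
            rw [← hk, ← X.iter_add _ _ hz, sub_add_cancel]
          obtain ⟨m', hm'⟩ := hsurj (q - k) (by rw [e]; exact Ioo_subset_Ico_self (hIJ hqI))
          have hin : S.iter m' (S.sep i) ∈ Ioo u v := by rw [heq, hm', e]; exact hqI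
          have l1 := hmono.lt_iff_lt (a := m) (b := m')
          have l2 := hmono.lt_iff_lt (a := 0) (b := m')
          have hav' : ¬ (k < q ∧ q ≤ 0 ∨ 0 < q ∧ q ≤ k) := fun hh => hav q hh (hIJ hqI)
          have hSm' : ¬ (m < m' ∧ m' ≤ 0 ∨ 0 < m' ∧ m' ≤ m) := fun hh => hSm m' hh hin
          omega
      · have := S.iter_mem m (z := S.sep i) (by rw [hSl, hSr]; exact hσ)
        rwa [hSl, hSr] at this
    · rintro ⟨hyD, hyJ⟩
      obtain ⟨j, hj⟩ := mem_iUnion.mp hyD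
      obtain ⟨k', rfl, hav⟩ := (Nu j y).mp hj
      have hz := X.sep_mem j
      -- last visit to `(t,w)`
      obtain ⟨k, ⟨hk0, hkJ⟩, hkmax⟩ := Int.exists_greatest_of_bdd
        (P := fun k => k ≤ 0 ∧ X.iter k (X.sep j) ∈ Ioo t w) ⟨0, fun z hz => hz.1⟩
        (by obtain ⟨n, hn⟩ := Mt _ hz; exact ⟨-(n : ℤ), by omega, hn⟩)
      have hσD : X.iter k (X.sep j) ∈ X.Div t w := by
        refine mem_iUnion.mpr ⟨j, (Nt j _).mpr ⟨k, rfl, fun m hm hmm => ?_⟩⟩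
        have := fun hh => hkmax m ⟨hh, hmm⟩
        omega
      have hσ := Ioo_subset_Ico_self hkJ
      obtain ⟨i, hi⟩ : X.iter k (X.sep j) ∈ {y | ∃ i : Fin s, S.sep i = y} := by
        rw [hsep]; exact ⟨hσD, hσ⟩
      rw [← hi] at hσ
      obtain ⟨φ, hmono, h0, heq, hsurj⟩ := hφ _ hσ
      have e : ∀ q, X.iter (q - k) (S.sep i) = X.iter q (X.sep j) := by
        intro q
        rw [hi, ← X.iter_add _ _ hz, sub_add_cancel]
      obtain ⟨m, hm⟩ := hsurj (k' - k) (by rw [e]; exact hyJ)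
      refine mem_iUnion.mpr ⟨i, (NS i _).mpr ⟨m, by rw [heq, hm, e], ?_⟩⟩
      intro m' hm' hin
      have hin' : X.iter (k + φ m') (X.sep j) ∈ Ioo u v := by
        rw [← e, add_sub_cancel_left, ← heq]; exact hin
      have l1 := hmono.lt_iff_lt (a := m) (b := m')
      have l2 := hmono.lt_iff_lt (a := 0) (b := m')
      have hav' : ¬ (k' < k + φ m' ∧ k + φ m' ≤ 0 ∨ 0 < k + φ m' ∧ k + φ m' ≤ k') :=
        fun hh => hav _ hh hin'
      have hmx : k + φ m' ≤ 0 → k + φ m' ≤ k := fun hh => hkmax (k + φ m') ⟨hh, hIJ hin'⟩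
      omega
  refine ⟨?_, fun _ => hDiv⟩
  have huJ : u ∈ Ico t w := ⟨hu, huv.trans_le hv⟩
  unfold IET.Admissible
  rw [hmain, hSl, hSr]
  constructor
  · rintro ⟨-, -, -, h1, h2⟩
    refine ⟨hu, huv, hv, ⟨h1, huJ⟩, ?_⟩
    rcases eq_or_lt_of_le hv with h | h
    · exact Or.inr h
    · rcases h2 with h2 | h2
      · exact Or.inl ⟨h2, by linarith, h⟩
      · linarith
  · rintro ⟨-, -, -, h1, h2⟩
    refine ⟨hlu, huv, hvr, h1.1, ?_⟩
    rcases h2 with h2 | h2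
    · exact Or.inl h2.1
    · rw [h2] at hDiv ⊢
      exact hwD.imp_left (fun h => hDiv h)
end

section
/- Let T be a minimal interval exchange transformation on [ℓ,r) defined over ℤ[√d], and suppose that for some point z ∈ [ℓ,r), some semi-interval J ⊆ [ℓ,r), and integers m,n ≥ 1 one has {T^i(z) : −m+1 ≤ i ≤ n−1} ∩ J = ∅. Then |J| = O(1/max{m,n}); that is, there is a constant C = C(T), independent of z, J, m, n, with |J| ≤ C/max{m,n}. -/
open Set

/-- The ring `ℤ[√d] = {m + n√d : m, n ∈ ℤ}` inside `ℝ`. -/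
def Zsd (d : ℕ) : Set ℝ := {x | ∃ m n : ℤ, x = (m : ℝ) + (n : ℝ) * Real.sqrt d}

/-- `Ψ(m + n√d) = max (|m|, |n|)` (the complexity of an element of `ℤ[√d]`). -/
noncomputable def Psi (d : ℕ) (x : ℝ) : ℝ :=
  sInf {t : ℝ | ∃ m n : ℤ, x = (m : ℝ) + (n : ℝ) * Real.sqrt d ∧ t = max |(m : ℝ)| |(n : ℝ)|}

/-- `Ψ(X) = max {Ψ(z) : z ∈ ∂X}`, the complexity of a set. -/
noncomputable def PsiSet (d : ℕ) (S : Set ℝ) : ℝ := sSup (Psi d '' frontier S)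

/-- Membership in the algebra `A([l,r))` of finite unions of half-open
intervals of `[l,r)` with endpoints in `ℤ[√d]`. -/
def InAlg (d : ℕ) (l r : ℝ) (S : Set ℝ) : Prop :=
  S ⊆ Set.Ico l r ∧ ∃ (n : ℕ) (e : Fin n → ℝ × ℝ),
    (∀ i, (e i).1 ∈ Zsd d ∧ (e i).2 ∈ Zsd d) ∧ S = ⋃ i, Set.Ico (e i).1 (e i).2

/-- An interval exchange transformation is defined over `Q ⊆ ℝ` if all its
interval boundaries and translation values lie in `Q`. -/
def IET.DefinedOver {s : ℕ} (X : IET s) (Q : Set ℝ) : Prop :=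
  (∀ i, X.γ i ∈ Q) ∧ ∀ i, X.α i ∈ Q

/-- `x = p + q√d` with conjugate bounded by `B`. -/
def QB (d : ℕ) (x B : ℝ) : Prop :=
  ∃ p q : ℤ, x = (p : ℝ) + (q : ℝ) * Real.sqrt d ∧ |(p : ℝ) - (q : ℝ) * Real.sqrt d| ≤ B

lemma QB.mono {d : ℕ} {x B B' : ℝ} (h : QB d x B) (hB : B ≤ B') : QB d x B' := by
  obtain ⟨p, q, h1, h2⟩ := h
  exact ⟨p, q, h1, h2.trans hB⟩

lemma QB.add {d : ℕ} {x y B B' : ℝ} (h : QB d x B) (h' : QB d y B') :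
    QB d (x + y) (B + B') := by
  obtain ⟨p, q, h1, h2⟩ := h
  obtain ⟨p', q', h1', h2'⟩ := h'
  refine ⟨p + p', q + q', ?_, ?_⟩
  · rw [h1, h1']; push_cast; ring
  · have := abs_add_le ((p : ℝ) - (q : ℝ) * Real.sqrt d) ((p' : ℝ) - (q' : ℝ) * Real.sqrt d)
    have e : ((p + p' : ℤ) : ℝ) - ((q + q' : ℤ) : ℝ) * Real.sqrt d =
      ((p : ℝ) - (q : ℝ) * Real.sqrt d) + ((p' : ℝ) - (q' : ℝ) * Real.sqrt d) := by
      push_cast; ring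
    rw [e]; linarith

lemma QB.neg {d : ℕ} {x B : ℝ} (h : QB d x B) : QB d (-x) B := by
  obtain ⟨p, q, h1, h2⟩ := h
  refine ⟨-p, -q, ?_, ?_⟩
  · rw [h1]; push_cast; ring
  · rw [← abs_neg]
    have e : -(((-p : ℤ) : ℝ) - ((-q : ℤ) : ℝ) * Real.sqrt d) =
      ((p : ℝ) - (q : ℝ) * Real.sqrt d) := by
      push_cast; ring
    rw [e]; exact h2

lemma QB.sub {d : ℕ} {x y B B' : ℝ} (h : QB d x B) (h' : QB d y B') :
    QB d (x - y) (B + B') := by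
  rw [sub_eq_add_neg]; exact h.add h'.neg

lemma QB.mul {d : ℕ} {x y B B' : ℝ} (h : QB d x B) (h' : QB d y B') :
    QB d (x * y) (B * B') := by
  obtain ⟨p, q, h1, h2⟩ := h
  obtain ⟨p', q', h1', h2'⟩ := h'
  have hs : Real.sqrt d * Real.sqrt d = d := Real.mul_self_sqrt (by positivity)
  refine ⟨p * p' + d * (q * q'), p * q' + q * p', ?_, ?_⟩
  · rw [h1, h1']; push_cast; linear_combination ((q : ℝ) * q') * hs
  · have e : ((p * p' + d * (q * q') : ℤ) : ℝ) - ((p * q' + q * p' : ℤ) : ℝ) * Real.sqrt d =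
      ((p : ℝ) - (q : ℝ) * Real.sqrt d) * ((p' : ℝ) - (q' : ℝ) * Real.sqrt d) := by
      push_cast; linear_combination (-((q : ℝ) * q')) * hs
    rw [e, abs_mul]
    exact mul_le_mul h2 h2' (abs_nonneg _) ((abs_nonneg _).trans h2)

lemma QB.pow {d : ℕ} {x B : ℝ} (h : QB d x B) (k : ℕ) : QB d (x ^ k) (B ^ k) := by
  induction k with
  | zero => exact ⟨1, 0, by simp, by simp⟩
  | succ k ih => rw [pow_succ, pow_succ]; exact ih.mul h

lemma not_sq {d : ℕ} (hd : Squarefree d) (hd2 : 2 ≤ d) : ¬ IsSquare d := by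
  rintro ⟨a, ha⟩
  have := hd a ⟨1, by simpa using ha⟩
  rw [Nat.isUnit_iff] at this
  subst this; omega

lemma QB.norm {d : ℕ} (hd : ¬ IsSquare d) {x B : ℝ} (h : QB d x B) (hx : x ≠ 0) :
    1 ≤ |x| * B := by
  obtain ⟨p, q, h1, h2⟩ := h
  have hs : Real.sqrt d * Real.sqrt d = d := Real.mul_self_sqrt (by positivity)
  have hirr : Irrational (Real.sqrt d) := by
    rwa [irrational_sqrt_natCast_iff]
  have hN : p * p - d * (q * q) ≠ 0 := by
    intro h0
    have h0' : (p : ℝ) * p - d * (q * q) = 0 := by exact_mod_cast h0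
    have : x * ((p : ℝ) - q * Real.sqrt d) = 0 := by
      rw [h1]; linear_combination h0' - ((q : ℝ) * q) * hs
    rcases mul_eq_zero.1 this with h | h
    · exact hx h
    · by_cases hq : q = 0
      · subst hq
        simp at h h1
        apply hx; rw [h1, h]; simp
      · apply hirr
        refine ⟨(p : ℚ) / q, ?_⟩
        have hq' : (q : ℝ) ≠ 0 := by exact_mod_cast hq
        push_cast
        field_simp
        linarith
  have h3 : (1 : ℝ) ≤ |((p * p - d * (q * q) : ℤ) : ℝ)| := by
    exact_mod_cast Int.one_le_abs hN
  have e : ((p * p - d * (q * q) : ℤ) : ℝ) = x * ((p : ℝ) - q * Real.sqrt d) := by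
    rw [h1]; push_cast; linear_combination ((q : ℝ) * q) * hs
  rw [e, abs_mul] at h3
  exact h3.trans (mul_le_mul_of_nonneg_left h2 (abs_nonneg _))

/-- Abstract piecewise translation data. -/
structure PT (d : ℕ) (T S : ℝ → ℝ) (l r A : ℝ) (c : Set ℝ) : Prop where
  hT : MapsTo T (Ico l r) (Ico l r)
  hS : MapsTo S (Ico l r) (Ico l r)
  hST : ∀ x ∈ Ico l r, S (T x) = x
  hTS : ∀ x ∈ Ico l r, T (S x) = x
  hfin : c.Finite
  hc : c ⊆ Ico l r
  hcA : ∀ x ∈ c, QB d x A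
  hl : QB d l A
  hr : QB d r A
  hA : 0 < A
  hbreak : ∀ x ∈ Ico l r, ∀ y ∈ Ico l r, x ≤ y → (∀ e ∈ c, ¬ (x < e ∧ e ≤ y)) → T y - y = T x - x
  hSQ : ∀ x ∈ Ico l r, ∀ B, QB d x B → QB d (S x) (B + A)

namespace PT

variable {d : ℕ} {T S : ℝ → ℝ} {l r A : ℝ} {c : Set ℝ}

lemma itT (h : PT d T S l r A c) (j : ℕ) {x : ℝ} (hx : x ∈ Ico l r) : T^[j] x ∈ Ico l r :=
  h.hT.iterate j hx

lemma itS (h : PT d T S l r A c) (j : ℕ) {x : ℝ} (hx : x ∈ Ico l r) : S^[j] x ∈ Ico l r :=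
  h.hS.iterate j hx

lemma itST (h : PT d T S l r A c) (j : ℕ) {x : ℝ} (hx : x ∈ Ico l r) : S^[j] (T^[j] x) = x := by
  induction j with
  | zero => rfl
  | succ j ih =>
    rw [Function.iterate_succ_apply' T, Function.iterate_succ_apply S, h.hST _ (h.itT j hx), ih]

lemma itSQ (h : PT d T S l r A c) (j : ℕ) {x B : ℝ} (hx : x ∈ Ico l r) (hQ : QB d x B) :
    QB d (S^[j] x) (B + j * A) := by
  induction j with
  | zero => simpa using hQ
  | succ j ih =>
    rw [Function.iterate_succ_apply']
    have := h.hSQ _ (h.itS j hx) _ ih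
    refine this.mono ?_
    push_cast; linarith

/-- Existence of a long interval around `y` on which `T^j`, `j ≤ N` are translations. -/
lemma component (hd : ¬ IsSquare d) (h : PT d T S l r A c) {u v B : ℝ} (hu : u ∈ Ico l r)
    (hv : v ∈ Ico l r) (huB : QB d u B) (hvB : QB d v B) (hAB : A ≤ B) (N : ℕ) {y : ℝ}
    (hy : y ∈ Ico l r) :
    ∃ a b, l ≤ a ∧ b ≤ r ∧ a < b ∧ 1 / (2 * (B + N * A)) ≤ b - a ∧
      ∀ j ≤ N, ∀ z ∈ Ico a b, T^[j] z - z = T^[j] y - y ∧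
        (T^[j] z ∈ Ico u v ↔ T^[j] y ∈ Ico u v) := by
  set C : Set ℝ := c ∪ {u, v} with hC
  have hCfin : C.Finite := h.hfin.union (by simp)
  have hCsub : C ⊆ Ico l r := by
    rintro x (hx | hx | hx)
    · exact h.hc hx
    · rw [hx]; exact hu
    · rw [hx]; exact hv
  have hCQ : ∀ x ∈ C, QB d x B := by
    rintro x (hx | hx | hx)
    · exact (h.hcA x hx).mono hAB
    · rw [hx]; exact huB
    · rw [hx]; exact hvB
  set F : Set ℝ := {l, r} ∪ ⋃ j ∈ Set.Iic N, (S^[j]) '' C with hF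
  have hFfin : F.Finite := by
    refine Set.Finite.union (by simp) ?_
    exact (Set.finite_Iic N).biUnion (fun j _ => hCfin.image _)
  have hFQ : ∀ x ∈ F, QB d x (B + N * A) := by
    have hA := h.hA
    have hNA : 0 ≤ (N : ℝ) * A := by positivity
    rintro x ((hx | hx) | hx)
    · rw [hx]; exact h.hl.mono (by linarith)
    · rw [hx]; exact h.hr.mono (by linarith)
    · simp only [Set.mem_iUnion, Set.mem_image, Set.mem_Iic] at hx
      obtain ⟨j, hj, e, he, rfl⟩ := hx
      refine (h.itSQ j (hCsub he) (hCQ e he)).mono ?_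
      have : (j : ℝ) ≤ N := by exact_mod_cast hj
      nlinarith
  obtain ⟨a, ⟨haF, hay⟩, hamax⟩ := Set.exists_max_image (F ∩ Iic y) id
    (hFfin.subset inter_subset_left) ⟨l, by simp [hF], hy.1⟩
  obtain ⟨b, ⟨hbF, hyb⟩, hbmin⟩ := Set.exists_min_image (F ∩ Ioi y) id
    (hFfin.subset inter_subset_left) ⟨r, by simp [hF], hy.2⟩
  simp only [id] at hamax hbmin
  have hla : l ≤ a := hamax l ⟨by simp [hF], hy.1⟩
  have hbr : b ≤ r := hbmin r ⟨by simp [hF], hy.2⟩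
  have hay' : a ≤ y := hay
  have hyb' : y < b := hyb
  have hgap : ∀ x ∈ F, ¬ (a < x ∧ x < b) := by
    rintro x hx ⟨h1, h2⟩
    rcases le_or_gt x y with h3 | h3
    · exact absurd (hamax x ⟨hx, h3⟩) (not_le.2 h1)
    · exact absurd (hbmin x ⟨hx, h3⟩) (not_le.2 h2)
  have hsub : ∀ z ∈ Ico a b, z ∈ Ico l r := fun z hz => ⟨hla.trans hz.1, hz.2.trans_le hbr⟩
  have hpos : 0 < B + N * A := by
    have hA := h.hA
    have hNA : 0 ≤ (N : ℝ) * A := by positivity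
    linarith
  -- no critical value strictly separates
  have hsep : ∀ j ≤ N, (∀ z ∈ Ico a b, T^[j] z - z = T^[j] y - y) →
      ∀ z1 ∈ Ico a b, ∀ z2 ∈ Ico a b, ∀ e ∈ C, ¬ (T^[j] z1 < e ∧ e ≤ T^[j] z2) := by
    rintro j hj hz z1 hz1 z2 hz2 e he ⟨h1, h2⟩
    have e1 := hz z1 hz1
    have e2 := hz z2 hz2
    have hs1 : z1 < z1 + (e - T^[j] z1) := by linarith
    have hs2 : z1 + (e - T^[j] z1) ≤ z2 := by linarith
    have hsI : z1 + (e - T^[j] z1) ∈ Ico a b := ⟨hz1.1.trans hs1.le, hs2.trans_lt hz2.2⟩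
    have e3 := hz _ hsI
    have e4 : T^[j] (z1 + (e - T^[j] z1)) = e := by linarith
    have e5 := h.itST j (hsub _ hsI)
    rw [e4] at e5
    refine hgap (S^[j] e) ?_ ?_
    · right
      simp only [Set.mem_iUnion, Set.mem_image, Set.mem_Iic]
      exact ⟨j, hj, e, he, rfl⟩
    · rw [e5]; exact ⟨hz1.1.trans_lt hs1, hsI.2⟩
  have htr : ∀ j ≤ N, ∀ z ∈ Ico a b, T^[j] z - z = T^[j] y - y := by
    intro j
    induction j with
    | zero => intro _ z _; simp
    | succ j ih =>
      intro hj
      have ih' := ih (by omega)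
      have key : ∀ z1 ∈ Ico a b, ∀ z2 ∈ Ico a b, z1 ≤ z2 →
          T^[j+1] z1 - z1 = T^[j+1] z2 - z2 := by
        intro z1 hz1 z2 hz2 h12
        have e1 := ih' z1 hz1
        have e2 := ih' z2 hz2
        have := h.hbreak _ (h.itT j (hsub _ hz1)) _ (h.itT j (hsub _ hz2)) (by linarith)
          (fun e he => hsep j (by omega) ih' z1 hz1 z2 hz2 e (Or.inl he))
        rw [Function.iterate_succ_apply', Function.iterate_succ_apply']
        linarith
      intro z hz
      rcases le_total z y with h1 | h1
      · exact key z hz y ⟨hay', hyb'⟩ h1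
      · exact (key y ⟨hay', hyb'⟩ z hz h1).symm
  refine ⟨a, b, hla, hbr, hay'.trans_lt hyb', ?_, fun j hj z hz => ⟨htr j hj z hz, ?_⟩⟩
  · have hab : 0 < b - a := by linarith
    have := ((hFQ b hbF).sub (hFQ a haF)).norm hd hab.ne'
    rw [abs_of_pos hab] at this
    rw [div_le_iff₀ (by linarith)]
    linarith
  · have hyI : y ∈ Ico a b := ⟨hay', hyb'⟩
    have s1 : ∀ e ∈ C, (e ≤ T^[j] z ↔ e ≤ T^[j] y) := by
      intro e he
      have n1 := hsep j hj (htr j hj) z hz y hyI e he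
      have n2 := hsep j hj (htr j hj) y hyI z hz e he
      constructor
      · intro h1
        by_contra h2
        exact n2 ⟨not_le.1 h2, h1⟩
      · intro h1
        by_contra h2
        exact n1 ⟨not_le.1 h2, h1⟩
    have su := s1 u (by simp [hC])
    have sv := s1 v (by simp [hC])
    simp only [Set.mem_Ico]
    rw [su, ← not_le, sv, not_le]

lemma log_sum (b : ℝ) (hb : 0 ≤ b) (N : ℕ) :
    Real.log ((N + 1 + b) / (1 + b)) ≤ ∑ j ∈ Finset.range N, 1 / ((j + 1 : ℝ) + b) := by
  induction N with
  | zero => simp [div_self (show (1 + b) ≠ 0 by positivity)]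
  | succ N ih =>
    rw [Finset.sum_range_succ]
    have e : (((N + 1 : ℕ) : ℝ) + 1 + b) / (1 + b) =
        ((N + 1 + b) / (1 + b)) * (1 + 1 / ((N + 1 : ℝ) + b)) := by
      push_cast
      field_simp
      ring
    rw [e, Real.log_mul (by positivity) (by positivity)]
    have := Real.log_le_sub_one_of_pos (show (0:ℝ) < 1 + 1 / ((N + 1 : ℝ) + b) by positivity)
    linarith

lemma core (hd : ¬ IsSquare d) (h : PT d T S l r A c) {u v B : ℝ} (hu : u ∈ Ico l r)
    (hv : v ∈ Ico l r) (huB : QB d u B) (hvB : QB d v B) (hAB : A ≤ B) (N : ℕ) {y : ℝ}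
    (hy : y ∈ Ico u v) (hav : ∀ j, 1 ≤ j → j ≤ N → T^[j] y ∉ Ico u v) :
    Real.log ((N + 1 + B / A) / (1 + B / A)) ≤ 2 * A * (r - l) := by
  have hA := h.hA
  have hyI : y ∈ Ico l r := ⟨hu.1.trans hy.1, hy.2.trans hv.2⟩
  choose a b hla hbr hab hlen hcomp using
    fun j : ℕ => component hd h hu hv huB hvB hAB (j + 1) hyI
  -- the interval visited at time `j + 1`
  let E : ℕ → Set ℝ := fun j =>
    Ico (a j + (T^[j+1] y - y)) (b j + (T^[j+1] y - y))
  have hE : ∀ j w, w ∈ E j → ∃ z ∈ Ico (a j) (b j), z ∈ Ico l r ∧ T^[j+1] z = w := by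
    intro j w hw
    have hz : w - (T^[j+1] y - y) ∈ Ico (a j) (b j) := by
      constructor
      · linarith [hw.1]
      · linarith [hw.2]
    refine ⟨_, hz, ⟨(hla j).trans hz.1, hz.2.trans_le (hbr j)⟩, ?_⟩
    linarith [(hcomp j (j+1) le_rfl _ hz).1]
  have hdis' : ∀ i j, i < j → j < N → Disjoint (E i) (E j) := by
    intro i j hij hj
    rw [Set.disjoint_left]
    intro w hwi hwj
    obtain ⟨z, hz, hzI, hzw⟩ := hE i w hwi
    obtain ⟨z', hz', hzI', hzw'⟩ := hE j w hwj
    have e1 : T^[i+1] (T^[j-i] z') = w := by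
      rw [← Function.iterate_add_apply, ← hzw']
      have e0 : i + 1 + (j - i) = j + 1 := by omega
      rw [e0]
    have e2 : T^[j-i] z' = z := by
      rw [← h.itST (i+1) (h.itT (j-i) hzI'), e1, ← hzw, h.itST (i+1) hzI]
    have m1 : z ∈ Ico u v := ((hcomp i 0 (by omega) z hz).2).2 hy
    rw [← e2] at m1
    exact hav (j-i) (by omega) (by omega) (((hcomp j (j-i) (by omega) z' hz').2).1 m1)
  have hdis : Set.PairwiseDisjoint (↑(Finset.range N)) E := by
    intro i hi j hj hij
    simp only [Finset.coe_range, Set.mem_Iio] at hi hj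
    rcases lt_or_gt_of_ne hij with h1 | h1
    · exact hdis' i j h1 hj
    · exact (hdis' j i h1 hi).symm
  have hsubE : (⋃ j ∈ Finset.range N, E j) ⊆ Ico l r := by
    intro w hw
    simp only [Set.mem_iUnion] at hw
    obtain ⟨j, _, hw⟩ := hw
    obtain ⟨z, _, hzI, rfl⟩ := hE j w hw
    exact h.itT _ hzI
  have hmeas : ∑ j ∈ Finset.range N, (b j - a j) ≤ r - l := by
    have h1 := MeasureTheory.measure_mono (μ := MeasureTheory.volume) hsubE
    rw [MeasureTheory.measure_biUnion_finset hdis (fun _ _ => measurableSet_Ico)] at h1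
    have hlr : 0 ≤ r - l := by linarith [hu.1, hu.2]
    have h2 : ∀ j ∈ Finset.range N, MeasureTheory.volume (E j) = ENNReal.ofReal (b j - a j) := by
      intro j _
      simp only [E, Real.volume_Ico]
      congr 1; ring
    rw [Finset.sum_congr rfl h2, Real.volume_Ico,
      ← ENNReal.ofReal_sum_of_nonneg (fun j _ => by linarith [hab j])] at h1
    exact (ENNReal.ofReal_le_ofReal_iff hlr).1 h1
  have hB : 0 < B := by linarith
  have h3 := log_sum (B / A) (by positivity) N
  have h4 : ∑ j ∈ Finset.range N, 1 / ((j + 1 : ℝ) + B / A) ≤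
      2 * A * ∑ j ∈ Finset.range N, (b j - a j) := by
    rw [Finset.mul_sum]
    refine Finset.sum_le_sum fun j _ => ?_
    have := hlen j
    have e : 1 / ((j + 1 : ℝ) + B / A) = 2 * A * (1 / (2 * (B + ((j + 1 : ℕ) : ℝ) * A))) := by
      push_cast
      field_simp
      ring
    rw [e]
    exact mul_le_mul_of_nonneg_left this (by positivity)
  calc _ ≤ _ := h3
    _ ≤ _ := h4
    _ ≤ _ := mul_le_mul_of_nonneg_left hmeas (by positivity)

lemma core' (hd : ¬ IsSquare d) (h : PT d T S l r A c) {u v B : ℝ} (hu : u ∈ Ico l r)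
    (hv : v ∈ Ico l r) (huB : QB d u B) (hvB : QB d v B) (hAB : A ≤ B) (N : ℕ) {y : ℝ}
    (hy : y ∈ Ico u v) (hav : ∀ j, 1 ≤ j → j ≤ N → T^[j] y ∉ Ico u v) :
    (N : ℝ) ≤ Real.exp (2 * A * (r - l)) * (1 + B / A) := by
  have h1 := core hd h hu hv huB hvB hAB N hy hav
  have hA := h.hA
  have hB : 0 < B := by linarith
  rw [Real.log_le_iff_le_exp (by positivity), div_le_iff₀ (by positivity)] at h1
  have : 0 ≤ B / A := by positivity
  linarith

end PT

/-- Elements of `ℤ[√d]` near `y` with controlled conjugate. -/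
lemma approx0 (d : ℕ) (hd2 : 2 ≤ d) (y : ℝ) :
    ∃ x, |x - y| ≤ (1 + Real.sqrt d) / 2 ∧ QB d x ((1 + Real.sqrt d) / 2) := by
  have hs : 0 < Real.sqrt d := Real.sqrt_pos.2 (by positivity)
  have h1 := abs_sub_round (y / 2)
  have h2 := abs_sub_round (y / (2 * Real.sqrt d))
  set p := round (y / 2)
  set q := round (y / (2 * Real.sqrt d))
  have h3 : |y / 2 - q * Real.sqrt d| ≤ Real.sqrt d / 2 := by
    have e : y / 2 - q * Real.sqrt d = (y / (2 * Real.sqrt d) - q) * Real.sqrt d := by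
      field_simp
    rw [e, abs_mul, abs_of_pos hs]
    nlinarith
  rw [abs_le] at h1 h3
  refine ⟨p + q * Real.sqrt d, ?_, p, q, rfl, ?_⟩
  · rw [abs_le]; constructor <;> linarith [h1.1, h1.2, h3.1, h3.2]
  · rw [abs_le]; constructor <;> linarith [h1.1, h1.2, h3.1, h3.2]

lemma unit_exists (d : ℕ) (hd : ¬ IsSquare d) (hd2 : 2 ≤ d) :
    ∃ e : ℝ, 0 < e ∧ e < 1 ∧ QB d e e⁻¹ := by
  have hd' : ¬ IsSquare (d : ℤ) := by
    rwa [Int.isSquare_natCast_iff]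
  obtain ⟨g, hx, hy⟩ := Pell.Solution₁.exists_pos_of_not_isSquare
    (show (0 : ℤ) < d by omega) hd'
  obtain ⟨x, y, hxy, hx, hy⟩ : ∃ x y : ℤ, x ^ 2 - d * y ^ 2 = 1 ∧ 1 < x ∧ 0 < y :=
    ⟨g.x, g.y, g.prop, hx, hy⟩
  have hs : Real.sqrt d * Real.sqrt d = d := Real.mul_self_sqrt (by positivity)
  have hs0 : 0 < Real.sqrt d := Real.sqrt_pos.2 (by positivity)
  have hx' : (1 : ℝ) < x := by exact_mod_cast hx
  have hy' : (0 : ℝ) < y := by exact_mod_cast hy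
  have hxy' : (x : ℝ) ^ 2 - d * (y : ℝ) ^ 2 = 1 := by exact_mod_cast hxy
  have hprod : ((x : ℝ) - y * Real.sqrt d) * (x + y * Real.sqrt d) = 1 := by
    linear_combination hxy' - (y : ℝ) ^ 2 * hs
  have hbig : 1 < (x : ℝ) + y * Real.sqrt d := by
    have : 0 < (y : ℝ) * Real.sqrt d := by positivity
    linarith
  have heq : (x : ℝ) - y * Real.sqrt d = ((x : ℝ) + y * Real.sqrt d)⁻¹ :=
    eq_inv_of_mul_eq_one_left hprod
  refine ⟨((x : ℝ) + y * Real.sqrt d)⁻¹, by positivity, inv_lt_one_of_one_lt₀ hbig, x, -y, ?_, ?_⟩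
  · rw [← heq]; push_cast; ring
  · rw [inv_inv]; push_cast
    rw [abs_of_pos (by linarith)]
    linarith

lemma approx (d : ℕ) (hd : ¬ IsSquare d) (hd2 : 2 ≤ d) (R : ℝ) :
    ∃ K : ℝ, 0 < K ∧ ∀ y δ : ℝ, 0 < δ → δ ≤ R → ∃ x, |x - y| ≤ δ ∧ QB d x (K / δ) := by
  obtain ⟨e, he0, he1, heQ⟩ := unit_exists d hd hd2
  set M := (1 + Real.sqrt d) / 2 with hM
  have hM0 : 0 < M := by positivity
  refine ⟨M * (M / e + |R|), by positivity, fun y δ hδ hR => ?_⟩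
  have hex : ∃ k : ℕ, e ^ k * M ≤ δ := by
    obtain ⟨k, hk⟩ := exists_pow_lt_of_lt_one (show 0 < δ / M by positivity) he1
    exact ⟨k, ((lt_div_iff₀ hM0).1 hk).le⟩
  classical
  have hk := Nat.find_spec hex
  have hmin := fun m => Nat.find_min hex (m := m)
  set k := Nat.find hex
  obtain ⟨x, hx, hxQ⟩ := approx0 d hd2 (y / e ^ k)
  have hek : 0 < e ^ k := by positivity
  refine ⟨e ^ k * x, ?_, ((heQ.pow k).mul hxQ).mono ?_⟩
  · have e1 : e ^ k * x - y = e ^ k * (x - y / e ^ k) := by field_simp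
    rw [e1, abs_mul, abs_of_pos hek]
    exact (mul_le_mul_of_nonneg_left hx hek.le).trans hk
  · have h1 : (e⁻¹) ^ k * δ ≤ M / e + |R| := by
      have hMe : 0 ≤ M / e := by positivity
      rcases Nat.eq_zero_or_pos k with h0 | h0
      · rw [h0]; simp; linarith [le_abs_self R]
      · have h2 := hmin (k - 1) (by omega)
        push Not at h2
        have h3 : (e⁻¹) ^ k * δ ≤ (e⁻¹) ^ k * (e ^ (k - 1) * M) :=
          mul_le_mul_of_nonneg_left h2.le (by positivity)
        have h4 : (e⁻¹) ^ k * (e ^ (k - 1) * M) = M / e := by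
          obtain ⟨m, hm⟩ : ∃ m, k = m + 1 := ⟨k - 1, by omega⟩
          rw [hm]; simp only [Nat.add_sub_cancel, inv_pow, pow_succ]
          field_simp
        linarith [abs_nonneg R]
    rw [le_div_iff₀ hδ, ← hM]
    nlinarith

lemma QB_family (d : ℕ) {k : ℕ} (f : Fin k → ℝ) (hf : ∀ i, f i ∈ Zsd d) :
    ∃ A : ℝ, 0 < A ∧ ∀ i, QB d (f i) A := by
  choose p q hpq using hf
  refine ⟨1 + ∑ i, |(p i : ℝ) - (q i : ℝ) * Real.sqrt d|, ?_, fun i => ⟨p i, q i, hpq i, ?_⟩⟩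
  · have : 0 ≤ ∑ i, |(p i : ℝ) - (q i : ℝ) * Real.sqrt d| :=
      Finset.sum_nonneg fun _ _ => abs_nonneg _
    linarith
  · have := Finset.single_le_sum (f := fun i => |(p i : ℝ) - (q i : ℝ) * Real.sqrt d|)
      (fun _ _ => abs_nonneg _) (Finset.mem_univ i)
    linarith

namespace IET

variable {s : ℕ} (X : IET s)

lemma exists_I {x : ℝ} (hx : x ∈ Ico X.l X.r) : ∃ i, x ∈ X.I i := by
  classical
  have hex : ∃ k : ℕ, ∃ h : k < s + 1, x < X.γ ⟨k, h⟩ :=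
    ⟨s, by omega, by have := X.γ_last; rw [Fin.last] at this; rw [this]; exact hx.2⟩
  obtain ⟨hk, hxk⟩ := Nat.find_spec hex
  have hmin := fun m => Nat.find_min hex (m := m)
  set k := Nat.find hex
  obtain ⟨m, hm⟩ : ∃ m, k = m + 1 := by
    refine Nat.exists_eq_succ_of_ne_zero ?_
    intro h0
    have h1 : (⟨k, hk⟩ : Fin (s + 1)) = 0 := Fin.ext h0
    rw [h1, X.γ_first] at hxk
    exact absurd hx.1 (not_le.2 hxk)
  refine ⟨⟨m, by omega⟩, ?_, ?_⟩
  · have := hmin m (by omega)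
    push Not at this
    exact this (by omega)
  · have h1 : (⟨k, hk⟩ : Fin (s + 1)) = Fin.succ ⟨m, by omega⟩ := Fin.ext hm
    rwa [h1] at hxk

lemma I_sub (i : Fin s) : X.I i ⊆ Ico X.l X.r := by
  intro x hx
  have h1 := X.γ_mono.monotone (Fin.zero_le i.castSucc)
  have h2 := X.γ_mono.monotone (Fin.le_last i.succ)
  rw [X.γ_first] at h1
  rw [X.γ_last] at h2
  exact ⟨h1.trans hx.1, hx.2.trans_le h2⟩

lemma sep_mem_I (i : Fin s) : X.sep i ∈ X.I i :=
  ⟨le_rfl, X.γ_mono Fin.castSucc_lt_succ⟩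

lemma T_sep (i : Fin s) : X.T (X.sep i) = X.δ i := X.hT i _ (X.sep_mem_I i)

lemma pt_fwd {d : ℕ} {A : ℝ} (hA : 0 < A) (hγ : ∀ i, QB d (X.γ i) A)
    (hα : ∀ i, QB d (X.α i) A) :
    PT d X.T X.Tinv X.l X.r A (range X.sep) where
  hT := X.hmaps
  hS := X.hinvmaps
  hST := X.hinv_left
  hTS := X.hinv_right
  hfin := Set.finite_range _
  hc := by rintro _ ⟨i, rfl⟩; exact X.I_sub i (X.sep_mem_I i)
  hcA := by rintro _ ⟨i, rfl⟩; exact hγ _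
  hl := by rw [← X.γ_first]; exact hγ _
  hr := by rw [← X.γ_last]; exact hγ _
  hA := hA
  hbreak := by
    intro x hx y hy hxy hno
    obtain ⟨j, hj⟩ := X.exists_I hy
    have h1 : X.sep j ≤ x := by
      by_contra h
      exact hno _ ⟨j, rfl⟩ ⟨not_le.1 h, hj.1⟩
    rw [X.hT j y hj, X.hT j x ⟨h1, hxy.trans_lt hj.2⟩]; ring
  hSQ := by
    intro x hx B hB
    obtain ⟨i, hi⟩ := X.exists_I (X.hinvmaps hx)
    have h1 := X.hT i _ hi
    rw [X.hinv_right x hx] at h1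
    have h2 : X.Tinv x = x - X.α i := by linarith
    rw [h2]; exact hB.sub (hα i)

lemma pt_bwd {d : ℕ} {A : ℝ} (hA : 0 < A) (hγ : ∀ i, QB d (X.γ i) A)
    (hα : ∀ i, QB d (X.α i) A) (hδ : ∀ i, QB d (X.δ i) A) :
    PT d X.Tinv X.T X.l X.r A (range X.δ) where
  hT := X.hinvmaps
  hS := X.hmaps
  hST := X.hinv_right
  hTS := X.hinv_left
  hfin := Set.finite_range _
  hc := by
    rintro _ ⟨i, rfl⟩
    rw [← T_sep]
    exact X.hmaps (X.I_sub i (X.sep_mem_I i))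
  hcA := by rintro _ ⟨i, rfl⟩; exact hδ _
  hl := by rw [← X.γ_first]; exact hγ _
  hr := by rw [← X.γ_last]; exact hγ _
  hA := hA
  hbreak := by
    intro x hx y hy hxy hno
    obtain ⟨j, hj⟩ := X.exists_I (X.hinvmaps hy)
    have h2 := X.hT j _ hj
    rw [X.hinv_right y hy] at h2
    have h3 : X.δ j = X.γ j.castSucc + X.α j := rfl
    have hj1 : X.γ j.castSucc ≤ X.Tinv y := hj.1
    have hj2 : X.Tinv y < X.γ j.succ := hj.2
    have h1 : X.δ j ≤ x := by
      by_contra h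
      exact hno _ ⟨j, rfl⟩ ⟨not_le.1 h, by linarith⟩
    have hxI : x - X.α j ∈ X.I j := ⟨by linarith, by linarith⟩
    have h4 := X.hT j _ hxI
    have h5 := X.hinv_left _ (X.I_sub j hxI)
    rw [h4, sub_add_cancel] at h5
    rw [h5]; linarith
  hSQ := by
    intro x hx B hB
    obtain ⟨i, hi⟩ := X.exists_I hx
    rw [X.hT i x hi]; exact hB.add (hα i)

lemma avoid_bound {d : ℕ} (hd : ¬ IsSquare d) {A : ℝ} (hA : 0 < A) (hγ : ∀ i, QB d (X.γ i) A)
    (hα : ∀ i, QB d (X.α i) A) (hδ : ∀ i, QB d (X.δ i) A) (hmin : X.Minimal)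
    {u v B : ℝ} (hu : u ∈ Ico X.l X.r) (hv : v ∈ Ico X.l X.r) (huv : u < v)
    (huB : QB d u B) (hvB : QB d v B) (hAB : A ≤ B) (N : ℕ)
    {w : ℝ} (hw : w ∈ Ico X.l X.r) (hav : ∀ i < N, X.T^[i] w ∉ Ico u v) :
    (N : ℝ) ≤ Real.exp (2 * A * (X.r - X.l)) * (1 + B / A) := by
  classical
  have hf := X.pt_fwd hA hγ hα
  have hb := X.pt_bwd hA hγ hα hδ
  obtain ⟨_, ⟨k, rfl⟩, hk⟩ := hmin w hw ((u + v) / 2)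
    ⟨by linarith [hu.1], by linarith [hv.2]⟩ ((v - u) / 2) (by linarith)
  rw [abs_lt] at hk
  have hk' : X.iter k w ∈ Ico u v := ⟨by linarith [hk.1], by linarith [hk.2]⟩
  by_cases hk0 : 0 ≤ k
  · have hex : ∃ a : ℕ, X.T^[a] w ∈ Ico u v := ⟨k.toNat, by simpa [iter, hk0] using hk'⟩
    have ha := Nat.find_spec hex
    have hm := fun m => Nat.find_min hex (m := m)
    set a := Nat.find hex
    have haN : N ≤ a := by
      by_contra h
      exact hav a (by omega) ha
    refine PT.core' hd hb hu hv huB hvB hAB N ha ?_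
    intro j hj1 hj2 hmem
    have e : X.T^[a] w = X.T^[j] (X.T^[a - j] w) := by
      rw [← Function.iterate_add_apply, Nat.add_sub_cancel' (by omega)]
    rw [e, hf.itST j (hf.itT _ hw)] at hmem
    exact hm (a - j) (by omega) hmem
  · have hex : ∃ a : ℕ, X.Tinv^[a] w ∈ Ico u v :=
      ⟨(-k).toNat, by simpa [iter, hk0] using hk'⟩
    have ha := Nat.find_spec hex
    have hm := fun m => Nat.find_min hex (m := m)
    set a := Nat.find hex
    refine PT.core' hd hf hu hv huB hvB hAB N ha ?_
    intro j hj1 hj2 hmem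
    rcases le_or_gt j a with h1 | h1
    · have e : X.Tinv^[a] w = X.Tinv^[j] (X.Tinv^[a - j] w) := by
        rw [← Function.iterate_add_apply, Nat.add_sub_cancel' (by omega)]
      rw [e, hb.itST j (hb.itT _ hw)] at hmem
      exact hm (a - j) (by omega) hmem
    · have e : X.T^[j] (X.Tinv^[a] w) = X.T^[j - a] w := by
        have : j = (j - a) + a := by omega
        conv_lhs => rw [this]
        rw [Function.iterate_add_apply, hb.itST a hw]
      rw [e] at hmem
      rcases Nat.eq_zero_or_pos a with h0 | h0
      · rw [h0] at ha
        exact hav 0 (by omega) ha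
      · exact hav (j - a) (by omega) hmem

end IET

/-- for a minimal interval exchange transformation defined over
`ℤ[√d]`, if the iterates `T^i(z)`, `−m+1 ≤ i ≤ n−1`, all avoid the
semi-interval `J = [u,v)`, then `|J| ≤ C / max{m,n}` for a constant `C = C(T)`
independent of `z`, `J`, `m`, `n`. -/
theorem iet_avoided_interval_is_short {s : ℕ} (d : ℕ) (hd : Squarefree d) (hd2 : 2 ≤ d)
    (X : IET s) (hdef : X.DefinedOver (Zsd d)) (hmin : X.Minimal) :
    ∃ C : ℝ, 0 < C ∧ ∀ z ∈ Set.Ico X.l X.r, ∀ u v : ℝ, X.l ≤ u → v ≤ X.r →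
      ∀ m n : ℕ, 1 ≤ m → 1 ≤ n →
        (∀ i : ℤ, -(m : ℤ) + 1 ≤ i → i ≤ (n : ℤ) - 1 → X.iter i z ∉ Set.Ico u v) →
        v - u ≤ C / (max m n : ℕ) := by
  have hsq := not_sq hd hd2
  obtain ⟨A1, hA1, hγ1⟩ := QB_family d X.γ hdef.1
  obtain ⟨A2, hA2, hα1⟩ := QB_family d X.α hdef.2
  have hA : 0 < A1 + A2 := by linarith
  have hγ : ∀ i, QB d (X.γ i) (A1 + A2) := fun i => (hγ1 i).mono (by linarith)
  have hα : ∀ i, QB d (X.α i) (A1 + A2) := fun i => (hα1 i).mono (by linarith)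
  have hδ : ∀ i, QB d (X.δ i) (A1 + A2) := fun i => (hγ1 _).add (hα1 i)
  generalize A1 + A2 = A at hA hγ hα hδ
  have hR : 0 < X.r - X.l := by linarith [X.hlr]
  obtain ⟨K, hK, happ⟩ := approx d hsq hd2 (X.r - X.l)
  set G := Real.exp (2 * A * (X.r - X.l)) with hG
  have hG0 : 0 < G := Real.exp_pos _
  refine ⟨G * (2 * (X.r - X.l) + 8 * K / A), by positivity, ?_⟩
  intro z hz u v hlu hvr m n hm hn hav
  have hmax : (0 : ℝ) < ((max m n : ℕ) : ℝ) := by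
    have : 0 < max m n := by omega
    exact_mod_cast this
  rcases le_or_gt v u with huv | huv
  · have : 0 ≤ G * (2 * (X.r - X.l) + 8 * K / A) / ((max m n : ℕ) : ℝ) := by positivity
    linarith
  have hD : 0 < v - u := by linarith
  obtain ⟨u', hu', huQ⟩ := happ (u + (v - u) / 4) ((v - u) / 8) (by linarith) (by linarith)
  obtain ⟨v', hv', hvQ⟩ := happ (u + 3 * (v - u) / 4) ((v - u) / 8) (by linarith) (by linarith)
  rw [abs_le] at hu' hv'
  obtain ⟨hu1, hu2⟩ := hu'
  obtain ⟨hv1, hv2⟩ := hv'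
  have hKd : 0 ≤ K / ((v - u) / 8) := by positivity
  have hb := X.pt_bwd hA hγ hα hδ
  have key := X.avoid_bound hsq hA hγ hα hδ hmin (u := u') (v := v')
    (B := A + K / ((v - u) / 8)) ⟨by linarith, by linarith⟩ ⟨by linarith, by linarith⟩
    (by linarith) (huQ.mono (by linarith)) (hvQ.mono (by linarith)) (by linarith) (m + n - 1)
    (w := X.Tinv^[m - 1] z) (hb.itT _ hz) (by
      intro i hi hmem
      have hmem' : X.T^[i] (X.Tinv^[m - 1] z) ∈ Ico u v :=
        ⟨by linarith [hmem.1], by linarith [hmem.2]⟩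
      refine hav ((i : ℤ) - ((m : ℤ) - 1)) (by omega) (by omega) ?_
      convert hmem' using 1
      rcases le_or_gt (m - 1) i with h1 | h1
      · have e1 : (0 : ℤ) ≤ (i : ℤ) - ((m : ℤ) - 1) := by omega
        have e2 : ((i : ℤ) - ((m : ℤ) - 1)).toNat = i - (m - 1) := by omega
        have e3 : i = (i - (m - 1)) + (m - 1) := by omega
        conv_rhs => rw [e3]
        rw [Function.iterate_add_apply, hb.itST _ hz, IET.iter, if_pos e1, e2]
      · have e1 : ¬ (0 : ℤ) ≤ (i : ℤ) - ((m : ℤ) - 1) := by omega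
        have e2 : (-((i : ℤ) - ((m : ℤ) - 1))).toNat = (m - 1) - i := by omega
        have e3 : m - 1 = i + ((m - 1) - i) := by omega
        conv_rhs => rw [e3]
        rw [Function.iterate_add_apply, hb.itST _ (hb.itT _ hz), IET.iter, if_neg e1, e2])
  have hN : ((max m n : ℕ) : ℝ) ≤ ((m + n - 1 : ℕ) : ℝ) := by
    have : max m n ≤ m + n - 1 := by omega
    exact_mod_cast this
  rw [le_div_iff₀ hmax]
  have h1 : (v - u) * ((max m n : ℕ) : ℝ) ≤
      (v - u) * (G * (1 + (A + K / ((v - u) / 8)) / A)) :=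
    mul_le_mul_of_nonneg_left (hN.trans key) hD.le
  have h2 : (v - u) * (G * (1 + (A + K / ((v - u) / 8)) / A)) =
      G * (2 * (v - u) + 8 * K / A) := by
    field_simp
    ring
  rw [h2] at h1
  refine h1.trans (mul_le_mul_of_nonneg_left ?_ hG0.le)
  linarith
end
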